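/- Assume Schanuel's conjecture over the reals. Let 0 ≤ k ≤ n and let P ∈ 𝕂[X₁,…,Xₙ,U₁,…,U_k] be such that Z(P) ⊆ ℝ^{n+k} is an irreducible real algebraic set over 𝕂. Let f : ℝⁿ → ℝ, f(x) = P(x₁,…,xₙ, e^{x₁},…,e^{x_k}), and suppose Z(f) ⊆ ℝⁿ has dimension n−1 and is irreducible in 𝕂[X, e^{X_k}], i.e., Z(f) cannot be written as a union of two proper subsets each of the form {x ∈ ℝⁿ : Q(x₁,…,xₙ, e^{x₁},…,e^{x_k}) = 0} with Q ∈ 𝕂[X₁,…,Xₙ,U₁,…,U_k]. Then Z(f) is irreducible as an exponential set over 𝕂 (i.e., with respect to zero sets of E-polynomials involving all n exponentials). -/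

import Mathlib

open MeasureTheory Set
open scoped ENNReal

noncomputable section

/-- `K` is a real algebraic extension of `ℚ`: every element of `K` is algebraic over `ℚ`. -/
def RealAlgExt (K : Subfield ℝ) : Prop := ∀ a : K, IsAlgebraic ℚ (a : ℝ)

/-- A real polynomial has all its coefficients in the subfield `K` of `ℝ`. -/
def CoeffsIn {σ : Type*} (K : Subfield ℝ) (P : MvPolynomial σ ℝ) : Prop :=
  ∀ m, P.coeff m ∈ K

/-- Evaluation of a polynomial in `X₁,…,Xₙ,U₁,…,Uₙ` at `(x, e^x)`:
the E-polynomial associated to `P`. -/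
def expEval {n : ℕ} (P : MvPolynomial (Fin n ⊕ Fin n) ℝ) (x : Fin n → ℝ) : ℝ :=
  MvPolynomial.eval (Sum.elim x fun i => Real.exp (x i)) P

/-- Exponential sets over `K` in `ℝⁿ`: zero sets of E-polynomials over `K`. -/
def IsExpSet {n : ℕ} (K : Subfield ℝ) (V : Set (Fin n → ℝ)) : Prop :=
  ∃ P : MvPolynomial (Fin n ⊕ Fin n) ℝ, CoeffsIn K P ∧ V = {x | expEval P x = 0}

/-- Real algebraic sets over `K` (in coordinates indexed by `σ`). -/
def IsAlgSet {σ : Type*} (K : Subfield ℝ) (S : Set (σ → ℝ)) : Prop :=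
  ∃ P : MvPolynomial σ ℝ, CoeffsIn K P ∧ S = {x | MvPolynomial.eval x P = 0}

/-- An exponential set is irreducible if it is nonempty and is not the union of
two proper exponential subsets. -/
def IsIrredExpSet {n : ℕ} (K : Subfield ℝ) (V : Set (Fin n → ℝ)) : Prop :=
  IsExpSet K V ∧ V.Nonempty ∧
    ¬ ∃ V₁ V₂ : Set (Fin n → ℝ),
      IsExpSet K V₁ ∧ IsExpSet K V₂ ∧ V = V₁ ∪ V₂ ∧ V₁ ⊂ V ∧ V₂ ⊂ V

/-- `T` is an irreducible component of `V`: a maximal irreducible exponential subset of `V`. -/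
def IsExpComponent {n : ℕ} (K : Subfield ℝ) (T V : Set (Fin n → ℝ)) : Prop :=
  IsIrredExpSet K T ∧ T ⊆ V ∧
    ∀ T', IsIrredExpSet K T' → T ⊆ T' → T' ⊆ V → T' = T

/-- A real algebraic set is irreducible over `K` if it is nonempty and is not the union of
two proper algebraic subsets over `K`. -/
def IsIrredAlgSet {σ : Type*} (K : Subfield ℝ) (V : Set (σ → ℝ)) : Prop :=
  IsAlgSet K V ∧ V.Nonempty ∧
    ¬ ∃ V₁ V₂ : Set (σ → ℝ),
      IsAlgSet K V₁ ∧ IsAlgSet K V₂ ∧ V = V₁ ∪ V₂ ∧ V₁ ⊂ V ∧ V₂ ⊂ V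

/-- `T` is an irreducible component over `K` of the real algebraic set `V`. -/
def IsAlgComponent {σ : Type*} (K : Subfield ℝ) (T V : Set (σ → ℝ)) : Prop :=
  IsIrredAlgSet K T ∧ T ⊆ V ∧
    ∀ T', IsIrredAlgSet K T' → T ⊆ T' → T' ⊆ V → T' = T

/-- Local (Hausdorff) dimension of `A` at `x`. -/
def locDim {n : ℕ} (A : Set (Fin n → ℝ)) (x : Fin n → ℝ) : ℝ≥0∞ :=
  ⨅ (ε : ℝ) (_ : 0 < ε), dimH (A ∩ Metric.ball x ε)

/-- `A_p`: the set of points of `A` at which `A` has local dimension `p`. -/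
def localSet {n : ℕ} (A : Set (Fin n → ℝ)) (p : ℕ) : Set (Fin n → ℝ) :=
  {x | x ∈ A ∧ locDim A x = (p : ℝ≥0∞)}

/-- The exponent vectors of the `U`-monomials of `P` (with nonzero coefficient in `𝕂[X]`). -/
def Uexps {n : ℕ} (P : MvPolynomial (Fin n ⊕ Fin n) ℝ) : Set (Fin n → ℕ) :=
  (fun (m : (Fin n ⊕ Fin n) →₀ ℕ) (i : Fin n) => m (Sum.inr i)) '' (P.support : Set _)

/-- The union `W_P` of the linear hyperplane sets associated to pairs of distinct
`U`-monomials of `P`. -/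
def WP {n : ℕ} (P : MvPolynomial (Fin n ⊕ Fin n) ℝ) : Set (Fin n → ℝ) :=
  {x | ∃ d e : Fin n → ℕ, d ∈ Uexps P ∧ e ∈ Uexps P ∧ d ≠ e ∧
    ∑ i, (d i : ℝ) * x i = ∑ i, (e i : ℝ) * x i}

/-- Schanuel's conjecture over the reals, with "the transcendence degree of
`ℚ(x₁,…,xₙ,e^{x₁},…,e^{xₙ})` over `ℚ` is less than `n`" expressed as: no `n`-tuple of
elements of `{x₁,…,xₙ,e^{x₁},…,e^{xₙ}}` is algebraically independent over `ℚ`. -/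
def SchanuelConjecture : Prop :=
  ∀ (n : ℕ) (x : Fin n → ℝ),
    (¬ ∃ v : Fin n → ℝ,
        (∀ i, v i ∈ Set.range x ∪ Set.range fun j => Real.exp (x j)) ∧
        AlgebraicIndependent ℚ v) →
    ∃ m : Fin n → ℤ, (∃ i, m i ≠ 0) ∧ ∑ i, (m i : ℝ) * x i = 0


/-- Exponential sets defined using only the first `k` exponentials. -/
def IsExpSetK {n k : ℕ} (hk : k ≤ n) (K : Subfield ℝ) (V : Set (Fin n → ℝ)) : Prop :=
  ∃ Q : MvPolynomial (Fin n ⊕ Fin k) ℝ, CoeffsIn K Q ∧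
    V = {x | MvPolynomial.eval
          (Sum.elim x fun j => Real.exp (x (Fin.castLE hk j))) Q = 0}

/-- Real algebraic numbers of large degree over a given number field are dense. -/
theorem exists_isAlgebraic_forall_aeval_ne_zero (L : Type*) [Field L] [NumberField L]
    [Algebra L ℝ] (N : ℕ) {a b : ℝ} (hab : a < b) :
    ∃ x ∈ Ioo a b, IsAlgebraic ℚ x ∧
      ∀ q : Polynomial L, q ≠ 0 → q.natDegree ≤ N → Polynomial.aeval x q ≠ 0 := by
  obtain ⟨p, hpN, hp⟩ := Nat.exists_infinite_primes (Module.finrank ℚ L * N + 1)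
  set θ : ℝ := (2 : ℝ) ^ ((p : ℝ)⁻¹) with hθ
  have hθ0 : 0 < θ := by positivity
  have hθp : θ ^ p = 2 := Real.rpow_inv_natCast_pow (by norm_num) hp.ne_zero
  have hirr : Irreducible (Polynomial.X ^ p - Polynomial.C (2 : ℚ)) := by
    refine X_pow_sub_C_irreducible_of_prime hp fun b hb => ?_
    have hb0 : b ≠ 0 := by
      rintro rfl
      simp [hp.ne_zero] at hb
    have h1 := congrArg (padicValRat 2) hb
    rw [padicValRat.pow] at h1
    have h2 : padicValRat 2 (2 : ℚ) = 1 := by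
      simpa using padicValRat.self (p := 2) (by norm_num)
    rw [h2] at h1
    have h3 : (p : ℤ) ∣ 1 := ⟨_, h1.symm⟩
    have h4 : p ∣ 1 := by exact_mod_cast h3
    exact hp.one_lt.ne' (Nat.dvd_one.1 h4)
  have hmin : minpoly ℚ θ = Polynomial.X ^ p - Polynomial.C (2 : ℚ) := by
    refine (minpoly.eq_of_irreducible_of_monic hirr ?_
      (Polynomial.monic_X_pow_sub_C _ hp.ne_zero)).symm
    simp [hθp]
  have hθint : IsIntegral ℚ θ := by
    by_contra h
    rw [minpoly.eq_zero h] at hmin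
    exact hirr.ne_zero hmin.symm
  have hdeg : (minpoly ℚ θ).natDegree = p := by
    rw [hmin, Polynomial.natDegree_X_pow_sub_C]
  obtain ⟨r, hr1, hr2, hr0⟩ : ∃ r : ℚ, a / θ < r ∧ (r : ℝ) < b / θ ∧ r ≠ 0 := by
    have h : a / θ < b / θ := by gcongr
    obtain ⟨r, h1, h2⟩ := exists_rat_btwn h
    by_cases hr : r = 0
    · subst hr
      obtain ⟨s, h3, h4⟩ := exists_rat_btwn h2
      refine ⟨s, h1.trans h3, h4, ?_⟩
      rintro rfl
      exact lt_irrefl _ h3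
    · exact ⟨r, h1, h2, hr⟩
  refine ⟨r * θ, ⟨(div_lt_iff₀ hθ0).1 hr1, (lt_div_iff₀ hθ0).1 hr2⟩, ?_, ?_⟩
  · exact (isAlgebraic_algebraMap (A := ℝ) r).mul hθint.isAlgebraic
  · intro q hq hqN hq0
    set q' : Polynomial L := q.comp (Polynomial.C (r : L) * Polynomial.X) with hq'
    have hrL : (r : L) ≠ 0 := by exact_mod_cast hr0
    have hd1 : (Polynomial.C (r : L) * Polynomial.X).natDegree = 1 :=
      Polynomial.natDegree_C_mul_X _ hrL
    have hq'd : q'.natDegree = q.natDegree := by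
      rw [hq', Polynomial.natDegree_comp, hd1, mul_one]
    have hq'0 : q' ≠ 0 := by
      intro h
      rw [hq', Polynomial.comp_eq_zero_iff] at h
      rcases h with h | ⟨-, h⟩
      · exact hq h
      · rw [h, Polynomial.natDegree_C] at hd1
        exact zero_ne_one hd1
    have hev : Polynomial.aeval θ q' = 0 := by
      rw [hq', Polynomial.aeval_comp]
      simpa using hq0
    have hLint : IsIntegral L θ := hθint.tower_top
    have hle : (minpoly L θ).natDegree ≤ N := by
      have := Polynomial.natDegree_le_of_dvd (minpoly.dvd L θ hev) hq'0
      omega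
    have : FiniteDimensional L (IntermediateField.adjoin L {θ}) :=
      IntermediateField.adjoin.finiteDimensional hLint
    have : FiniteDimensional ℚ (IntermediateField.adjoin L {θ}) :=
      FiniteDimensional.trans ℚ L _
    have h1 : Module.finrank ℚ (IntermediateField.adjoin L {θ}) ≤ Module.finrank ℚ L * N := by
      rw [← Module.finrank_mul_finrank ℚ L, IntermediateField.adjoin.finrank hLint]
      gcongr
    have h2 : (minpoly ℚ (IntermediateField.AdjoinSimple.gen L θ)).natDegree ≤
        Module.finrank ℚ (IntermediateField.adjoin L {θ}) := minpoly.natDegree_le _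
    have h3 : minpoly ℚ (IntermediateField.AdjoinSimple.gen L θ) = minpoly ℚ θ := by
      have := minpoly.algebraMap_eq (A := ℚ) (B := IntermediateField.adjoin L {θ}) (B' := ℝ)
        (FaithfulSMul.algebraMap_injective _ _) (IntermediateField.AdjoinSimple.gen L θ)
      rw [← this, IntermediateField.AdjoinSimple.algebraMap_gen]
    rw [h3, hdeg] at h2
    omega

/-- Algebraic points satisfying no nontrivial relation of bounded degree over a given number
field are dense. -/
theorem exists_generic_mem_pi_Ioo (F : Type) [Field F] [NumberField F] [Algebra F ℝ]
    (N d : ℕ) (a b : Fin d → ℝ) (hab : ∀ i, a i < b i) :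
    ∃ x : Fin d → ℝ, (∀ i, x i ∈ Ioo (a i) (b i)) ∧ (∀ i, IsAlgebraic ℚ (x i)) ∧
      ∀ p : MvPolynomial (Fin d) F, p ≠ 0 → (∀ i, p.degreeOf i ≤ N) →
        MvPolynomial.aeval x p ≠ 0 := by
  induction d with
  | zero =>
    refine ⟨0, fun i => i.elim0, fun i => i.elim0, fun p hp _ h => hp ?_⟩
    rw [MvPolynomial.eq_C_of_isEmpty p] at h ⊢
    rw [MvPolynomial.aeval_C, map_eq_zero] at h
    rw [h, map_zero]
  | succ d ih =>
    obtain ⟨x, hxI, hxa, hx⟩ := ih (fun i => a i.succ) (fun i => b i.succ) fun i => hab _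
    set L : IntermediateField F ℝ := IntermediateField.adjoin F (range x) with hL
    have : FiniteDimensional F L := by
      apply IntermediateField.finiteDimensional_adjoin
      rintro _ ⟨i, rfl⟩
      exact ((hxa i).tower_top F).isIntegral
    have : FiniteDimensional ℚ L := FiniteDimensional.trans ℚ F L
    have : NumberField L := ⟨⟩
    obtain ⟨y, hyI, hya, hy⟩ := exists_isAlgebraic_forall_aeval_ne_zero L N (hab 0)
    refine ⟨Fin.cons y x, fun i => ?_, fun i => ?_, fun p hp hN => ?_⟩
    · refine Fin.cases ?_ (fun i => ?_) i
      · simpa using hyI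
      · simpa using hxI i
    · refine Fin.cases ?_ (fun i => ?_) i
      · simpa using hya
      · simpa using hxa i
    · have hxL : ∀ i, x i ∈ L := fun i =>
        IntermediateField.subset_adjoin F _ ⟨i, rfl⟩
      set x' : Fin d → L := fun i => ⟨x i, hxL i⟩
      have hval : ∀ c : MvPolynomial (Fin d) F,
          ((MvPolynomial.aeval x' c : L) : ℝ) = MvPolynomial.aeval x c := by
        intro c
        have := MvPolynomial.map_aeval x' (algebraMap L ℝ) c
        rw [← IntermediateField.algebraMap_apply, this, MvPolynomial.aeval_def,
          ← IsScalarTower.algebraMap_eq]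
        rfl
      set P := MvPolynomial.finSuccEquiv F d p with hP
      have hP0 : P ≠ 0 := by simpa [hP] using hp
      set q : Polynomial L := P.map (MvPolynomial.aeval x' : _ →ₐ[F] L).toRingHom with hq
      have hlead : q.coeff P.natDegree ≠ 0 := by
        rw [hq, Polynomial.coeff_map]
        intro h
        have h1 : MvPolynomial.aeval x (P.coeff P.natDegree) = 0 := by
          rw [← hval]
          exact_mod_cast congrArg (Subtype.val) h
        refine hx _ ?_ (fun i => ?_) h1
        · simpa using hP0
        · exact (MvPolynomial.degreeOf_coeff_finSuccEquiv p i _).trans (hN _)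
      have hq0 : q ≠ 0 := by
        intro h
        rw [h] at hlead
        simp at hlead
      have hqN : q.natDegree ≤ N := by
        refine Polynomial.natDegree_map_le.trans ?_
        rw [hP, MvPolynomial.natDegree_finSuccEquiv]
        exact hN 0
      have hfin := hy q hq0 hqN
      have hcomp : MvPolynomial.aeval (Fin.cons y x : Fin (d + 1) → ℝ) p =
          Polynomial.aeval y q := by
        have key : (MvPolynomial.aeval (Fin.cons y x : Fin (d + 1) → ℝ) :
            MvPolynomial (Fin (d + 1)) F →ₐ[F] ℝ) =
            (((Polynomial.aeval y : Polynomial L →ₐ[L] ℝ).restrictScalars F).comp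
              (Polynomial.mapAlgHom (MvPolynomial.aeval x'))).comp
              (MvPolynomial.finSuccEquiv F d).toAlgHom := by
          refine MvPolynomial.algHom_ext fun i => ?_
          refine Fin.cases ?_ (fun i => ?_) i
          · simp [MvPolynomial.finSuccEquiv_X_zero]
          · simp [MvPolynomial.finSuccEquiv_X_succ, x']
        exact DFunLike.congr_fun key p
      rwa [hcomp]

/-- Under Schanuel's conjecture, exponentials of linearly independent algebraic numbers are
algebraically independent. -/
theorem SchanuelConjecture.algebraicIndependent_exp (hSch : SchanuelConjecture) {d : ℕ}
    (z : Fin d → ℝ) (hz : ∀ i, IsAlgebraic ℚ (z i))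
    (hli : ∀ m : Fin d → ℤ, ∑ i, (m i : ℝ) * z i = 0 → m = 0) :
    AlgebraicIndependent ℚ fun i => Real.exp (z i) := by
  obtain ⟨v, hv, hvi⟩ : ∃ v : Fin d → ℝ,
      (∀ i, v i ∈ Set.range z ∪ Set.range fun j => Real.exp (z j)) ∧
        AlgebraicIndependent ℚ v := by
    by_contra h
    obtain ⟨m, ⟨i, hi⟩, hm⟩ := hSch d z h
    exact hi (congrFun (hli m hm) i)
  have h1 : ∀ i, ∃ j, Real.exp (z j) = v i := by
    intro i
    rcases hv i with ⟨j, hj⟩ | ⟨j, hj⟩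
    · exact absurd (hj ▸ hz j) (hvi.transcendental i)
    · exact ⟨j, hj⟩
  choose φ hφ using h1
  have hinj : Function.Injective φ := by
    intro i j hij
    apply hvi.injective
    rw [← hφ, ← hφ, hij]
  set ψ := Equiv.ofBijective φ (Finite.injective_iff_bijective.1 hinj)
  have h2 : v ∘ ψ.symm = fun i => Real.exp (z i) := by
    funext i
    rw [Function.comp_apply, ← hφ]
    exact congrArg (fun t => Real.exp (z t)) (ψ.apply_symm_apply i)
  rw [← h2]
  exact hvi.comp _ ψ.symm.injective

namespace MvPolynomial

variable {F σ κ : Type*} [CommRing F]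

variable (F σ κ) in
/-- Polynomials in two groups of variables as polynomials in the second group. -/
def nestEquiv : MvPolynomial (σ ⊕ κ) F ≃ₐ[F] MvPolynomial κ (MvPolynomial σ F) :=
  (renameEquiv F (Equiv.sumComm σ κ)).trans (sumAlgEquiv F κ σ)

@[simp]
theorem nestEquiv_X_inl (i : σ) : nestEquiv F σ κ (X (Sum.inl i)) = C (X i) := by
  simp [nestEquiv]

@[simp]
theorem nestEquiv_X_inr (i : κ) : nestEquiv F σ κ (X (Sum.inr i)) = X i := by
  simp [nestEquiv]

theorem coeff_coeff_nestEquiv (p : MvPolynomial (σ ⊕ κ) F) (a : κ →₀ ℕ) (b : σ →₀ ℕ) :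
    coeff b (coeff a (nestEquiv F σ κ p)) =
      coeff (Finsupp.sumFinsuppAddEquivProdFinsupp.symm (b, a)) p := by
  have h1 : (Finsupp.sumFinsuppAddEquivProdFinsupp.symm (b, a) : σ ⊕ κ →₀ ℕ).mapDomain
      (Equiv.sumComm σ κ) = Finsupp.sumFinsuppAddEquivProdFinsupp.symm (a, b) := by
    ext i
    rw [← Finsupp.equivMapDomain_eq_mapDomain, Finsupp.equivMapDomain_apply]
    cases i <;> simp
  have h2 : coeff b (coeff a (sumAlgEquiv F κ σ (rename (Equiv.sumComm σ κ) p))) =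
      coeff (Finsupp.sumFinsuppAddEquivProdFinsupp.symm (a, b))
        (rename (Equiv.sumComm σ κ) p) := by
    simp [sumAlgEquiv, coeff, AddMonoidAlgebra.curryAlgEquiv, AddMonoidAlgebra.curryRingEquiv,
      AddMonoidAlgebra.curryAddEquiv]
  change coeff b (coeff a (sumAlgEquiv F κ σ (rename (Equiv.sumComm σ κ) p))) = _
  rw [h2, ← h1, coeff_rename_mapDomain _ (Equiv.sumComm σ κ).injective]

theorem degreeOf_coeff_nestEquiv_le (p : MvPolynomial (σ ⊕ κ) F) (a : κ →₀ ℕ) (i : σ) :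
    degreeOf i (coeff a (nestEquiv F σ κ p)) ≤ p.totalDegree := by
  rw [degreeOf_le_iff]
  intro m hm
  rw [mem_support_iff, coeff_coeff_nestEquiv, ← mem_support_iff] at hm
  have h1 := (degreeOf_le_iff (n := Sum.inl i)).1 (degreeOf_le_totalDegree p (Sum.inl i)) _ hm
  simpa using h1

theorem aeval_sumElim_eq_nestEquiv {A : Type*} [CommRing A] [Algebra F A] (x : σ → A)
    (y : κ → A) (p : MvPolynomial (σ ⊕ κ) F) :
    aeval (Sum.elim x y) p =
      eval y (map (aeval x : MvPolynomial σ F →ₐ[F] A).toRingHom (nestEquiv F σ κ p)) := by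
  induction p using MvPolynomial.induction_on with
  | C a =>
    have : nestEquiv F σ κ (C a) = C (C a) := by simp [nestEquiv]
    rw [this]
    simp
  | add p q hp hq => simp only [map_add, hp, hq]
  | mul_X p i hp =>
    rw [map_mul, hp, map_mul, map_mul, map_mul]
    cases i <;> simp

end MvPolynomial

open MvPolynomial in
theorem eq_zero_of_eval_map_aeval_eq_zero {F : Type} [Field F]
    [NumberField F] [Algebra F ℝ] {d : ℕ} {κ : Type*} {N : ℕ} {x : Fin d → ℝ}
    (hxa : ∀ i, IsAlgebraic ℚ (x i))
    (hx : ∀ p : MvPolynomial (Fin d) F, p ≠ 0 → (∀ i, p.degreeOf i ≤ N) → aeval x p ≠ 0)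
    {y : κ → ℝ} (hy : AlgebraicIndependent ℚ y) (G : MvPolynomial κ (MvPolynomial (Fin d) F))
    (hGN : ∀ a i, degreeOf i (coeff a G) ≤ N)
    (h0 : eval y (map (aeval x : MvPolynomial (Fin d) F →ₐ[F] ℝ).toRingHom G) = 0) :
    G = 0 := by
  by_contra hG
  obtain ⟨a, ha⟩ := ne_zero_iff.1 hG
  have hya := hy.algebraicClosure
  have halg : ∀ p : MvPolynomial (Fin d) F, aeval x p ∈ algebraicClosure ℚ ℝ := by
    intro p
    rw [mem_algebraicClosure_iff]
    induction p using MvPolynomial.induction_on with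
    | C a =>
      rw [aeval_C]
      exact (Algebra.IsAlgebraic.isAlgebraic (R := ℚ) a).algebraMap
    | add p q hp hq => rw [map_add]; exact hp.add hq
    | mul_X p i hp => rw [map_mul, aeval_X]; exact hp.mul (hxa i)
  let ψ : MvPolynomial (Fin d) F →+* algebraicClosure ℚ ℝ :=
    (aeval x : MvPolynomial (Fin d) F →ₐ[F] ℝ).toRingHom.codRestrict _ halg
  have hψ : (algebraMap (algebraicClosure ℚ ℝ) ℝ).comp ψ =
      (aeval x : MvPolynomial (Fin d) F →ₐ[F] ℝ).toRingHom := by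
    ext <;> rfl
  rw [← hψ, ← map_map, eval_map, ← aeval_def] at h0
  have h1 := hya.eq_zero_of_aeval_eq_zero _ h0
  have h2 := congrArg (coeff a) h1
  rw [coeff_map, coeff_zero] at h2
  have h3 := congrArg (algebraMap (algebraicClosure ℚ ℝ) ℝ) h2
  rw [map_zero] at h3
  refine hx _ ha (hGN a) ?_
  rw [← h3]
  rfl

open MvPolynomial in
theorem aeval_sumElim_ne_zero {F : Type} [Field F]
    [NumberField F] [Algebra F ℝ] {d : ℕ} {κ : Type*} (N : ℕ) (x : Fin d → ℝ)
    (hxa : ∀ i, IsAlgebraic ℚ (x i))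
    (hx : ∀ p : MvPolynomial (Fin d) F, p ≠ 0 → (∀ i, p.degreeOf i ≤ N) → aeval x p ≠ 0)
    (y : κ → ℝ) (hy : AlgebraicIndependent ℚ y) (R : MvPolynomial (Fin d ⊕ κ) F)
    (hR : R ≠ 0) (hRN : R.totalDegree ≤ N) : aeval (Sum.elim x y) R ≠ 0 := by
  intro h0
  rw [aeval_sumElim_eq_nestEquiv] at h0
  have := eq_zero_of_eval_map_aeval_eq_zero hxa hx hy _
    (fun a i => (degreeOf_coeff_nestEquiv_le R a i).trans hRN) h0
  exact hR (by simpa using this)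

namespace MvPolynomial

/-- Elimination of one variable from two coprime polynomials. -/
theorem exists_ne_zero_rename_mem_span {F σ : Type*} [Field F] [DecidableEq σ]
    {P Q : MvPolynomial σ F} (hP : Irreducible P) (hPQ : ¬ P ∣ Q) (v : σ) :
    ∃ R : MvPolynomial {w // w ≠ v} F, R ≠ 0 ∧
      rename Subtype.val R ∈ Ideal.span {P, Q} := by
  let Φ : MvPolynomial σ F ≃ₐ[F] Polynomial (MvPolynomial {w // w ≠ v} F) :=
    (renameEquiv F (Equiv.optionSubtypeNe v).symm).trans (optionEquivLeft F _)
  have hΦ : ∀ R : MvPolynomial {w // w ≠ v} F,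
      Φ (rename Subtype.val R) = Polynomial.C R := by
    intro R
    have : (Φ.toAlgHom.comp (rename Subtype.val) :
        MvPolynomial {w // w ≠ v} F →ₐ[F] Polynomial (MvPolynomial {w // w ≠ v} F)) =
        Algebra.algHom F (MvPolynomial {w // w ≠ v} F) _ := by
      refine algHom_ext fun w => ?_
      simp [Φ, Equiv.optionSubtypeNe_symm_of_ne w.2]
      rfl
    exact DFunLike.congr_fun this R
  have hp : Irreducible (Φ P) := (MulEquiv.irreducible_iff Φ).2 hP
  have hpq : ¬ Φ P ∣ Φ Q := by rwa [map_dvd_iff]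
  obtain ⟨R, hR0, u, w, hR⟩ : ∃ R : MvPolynomial {w // w ≠ v} F, R ≠ 0 ∧
      ∃ u w, u * Φ P + w * Φ Q = Polynomial.C R := by
    by_cases hdeg : (Φ P).natDegree = 0
    · rw [Polynomial.natDegree_eq_zero] at hdeg
      obtain ⟨c, hc⟩ := hdeg
      refine ⟨c, ?_, 1, 0, by rw [hc]; ring⟩
      rintro rfl
      rw [Polynomial.C_0] at hc
      exact hp.ne_zero hc.symm
    · have hprim := hp.isPrimitive hdeg
      let L := FractionRing (MvPolynomial {w // w ≠ v} F)
      have hirr : Irreducible ((Φ P).map (algebraMap _ L)) :=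
        (hprim.irreducible_iff_irreducible_map_fraction_map).1 hp
      have hnd : ¬ (Φ P).map (algebraMap _ L) ∣ (Φ Q).map (algebraMap _ L) := fun h =>
        hpq (hprim.dvd_of_fraction_map_dvd_fraction_map h)
      obtain ⟨u, w, huw⟩ := (hirr.coprime_iff_not_dvd).2 hnd
      obtain ⟨b, hb, hu⟩ := IsLocalization.integerNormalization_spec
        (nonZeroDivisors (MvPolynomial {w // w ≠ v} F)) u
      obtain ⟨c, hc, hw⟩ := IsLocalization.integerNormalization_spec
        (nonZeroDivisors (MvPolynomial {w // w ≠ v} F)) w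
      refine ⟨b * c, mul_ne_zero (nonZeroDivisors.ne_zero hb) (nonZeroDivisors.ne_zero hc),
        Polynomial.C c * IsLocalization.integerNormalization (nonZeroDivisors _) u,
        Polynomial.C b * IsLocalization.integerNormalization (nonZeroDivisors _) w, ?_⟩
      apply Polynomial.map_injective (algebraMap _ L) (IsFractionRing.injective _ L)
      simp only [Polynomial.map_add, Polynomial.map_mul, hu, hw, Polynomial.map_C, map_mul, Algebra.smul_def]
      linear_combination (Polynomial.C (algebraMap _ L b) * Polynomial.C (algebraMap _ L c)) * huw
  refine ⟨R, hR0, Ideal.mem_span_pair.2 ⟨Φ.symm u, Φ.symm w, ?_⟩⟩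
  apply Φ.injective
  rw [hΦ, ← hR]
  simp

theorem dvd_of_aeval_eq_zero {F σ τ : Type*} [CommRing F] {T : MvPolynomial σ F}
    (s : σ → MvPolynomial τ F) (ι : τ → σ) (h : ∀ w, T ∣ X w - rename ι (s w))
    {R : MvPolynomial σ F} (hR : aeval s R = 0) : T ∣ R := by
  have h1 : ((Ideal.Quotient.mkₐ F (Ideal.span {T})).comp (rename ι)).comp (aeval s) =
      Ideal.Quotient.mkₐ F (Ideal.span {T}) := by
    refine algHom_ext fun w => ?_
    simp only [AlgHom.comp_apply, aeval_X, Ideal.Quotient.mkₐ_eq_mk]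
    rw [Ideal.Quotient.eq, Ideal.mem_span_singleton, ← neg_sub, dvd_neg]
    exact h w
  have h2 := DFunLike.congr_fun h1 R
  simp only [AlgHom.comp_apply, hR, map_zero] at h2
  exact (Ideal.Quotient.eq_zero_iff_dvd T R).1 h2.symm

variable {F : Type*} [Field F] {d : ℕ}

/-- The linear form `X j - ∑ i, r i * X (j.succAbove i)`. -/
def hyperplaneForm (j : Fin (d + 1)) (r : Fin d → F) : MvPolynomial (Fin (d + 1)) F :=
  X j - ∑ i, C (r i) * X (j.succAbove i)

/-- The substitution eliminating `X j` on the hyperplane `X j = ∑ i, r i * X (j.succAbove i)`. -/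
def hyperplaneSubst (j : Fin (d + 1)) (r : Fin d → F) :
    Fin (d + 1) → MvPolynomial (Fin d) F :=
  j.insertNth (∑ i, C (r i) * X i) X

theorem hyperplaneForm_dvd_X_sub (j : Fin (d + 1)) (r : Fin d → F) (w : Fin (d + 1)) :
    hyperplaneForm j r ∣ X w - rename j.succAbove (hyperplaneSubst j r w) := by
  rcases eq_or_ne w j with rfl | hw
  · simp [hyperplaneForm, hyperplaneSubst]
  · obtain ⟨i, rfl⟩ := Fin.exists_succAbove_eq hw
    simp [hyperplaneSubst]

theorem aeval_hyperplaneSubst_hyperplaneForm (j : Fin (d + 1)) (r : Fin d → F) :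
    aeval (hyperplaneSubst j r) (hyperplaneForm j r) = 0 := by
  simp [hyperplaneSubst, hyperplaneForm, algebraMap_eq]

theorem eval_zero_hyperplaneForm (j : Fin (d + 1)) (r : Fin d → F) :
    eval 0 (hyperplaneForm j r) = 0 := by
  simp [hyperplaneForm]

theorem hyperplaneForm_ne_zero (j : Fin (d + 1)) (r : Fin d → F) : hyperplaneForm j r ≠ 0 := by
  intro h
  have := congrArg (eval (Pi.single j (1 : F))) h
  simp [hyperplaneForm] at this

theorem prime_hyperplaneForm (j : Fin (d + 1)) (r : Fin d → F) :
    Prime (hyperplaneForm j r) := by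
  refine ⟨hyperplaneForm_ne_zero j r, fun h => ?_, fun p q hpq => ?_⟩
  · have := h.map (eval (0 : Fin (d + 1) → F))
    rw [eval_zero_hyperplaneForm] at this
    exact not_isUnit_zero this
  · obtain ⟨c, hc⟩ := hpq
    have h1 := congrArg (aeval (hyperplaneSubst j r)) hc
    rw [map_mul, map_mul, aeval_hyperplaneSubst_hyperplaneForm, zero_mul, mul_eq_zero] at h1
    exact h1.imp
      (dvd_of_aeval_eq_zero _ _ (hyperplaneForm_dvd_X_sub j r))
      (dvd_of_aeval_eq_zero _ _ (hyperplaneForm_dvd_X_sub j r))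

theorem prime_rename {σ τ : Type*} {ι : σ → τ} (hι : Function.Injective ι)
    {p : MvPolynomial σ F} (hp : Prime p) : Prime (rename ι p) := by
  have h1 : rename ι p = rename ((↑) : Set.range ι → τ)
      (renameEquiv F (Equiv.ofInjective ι hι) p) := by
    rw [renameEquiv_apply, rename_rename]
    rfl
  rw [h1, prime_rename_iff]
  exact (MulEquiv.prime_iff (renameEquiv F (Equiv.ofInjective ι hι))).2 hp

end MvPolynomial

open MvPolynomial

theorem eq_zero_of_sum_intCast_mul_eq_zero {F : Type} [Field F] [CharZero F] [Algebra F ℝ]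
    {d N : ℕ} (hN : 1 ≤ N) {x : Fin d → ℝ}
    (hx : ∀ p : MvPolynomial (Fin d) F, p ≠ 0 → (∀ i, p.degreeOf i ≤ N) → aeval x p ≠ 0)
    (m : Fin d → ℤ) (hm : ∑ i, (m i : ℝ) * x i = 0) : m = 0 := by
  by_contra hne
  set p : MvPolynomial (Fin d) F := ∑ i, C (m i : F) * X i with hp
  refine hx p ?_ (fun i => ?_) ?_
  · intro h0
    obtain ⟨i, hi⟩ := Function.ne_iff.1 hne
    have h1 := congrArg (eval (Pi.single i (1 : F))) h0
    simp [hp, Pi.single_apply] at h1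
    exact hi h1
  · refine (degreeOf_le_totalDegree p i).trans ((totalDegree_finsetSum _ _).trans ?_)
    refine Finset.sup_le fun i _ => ?_
    refine (totalDegree_mul _ _).trans ?_
    rw [totalDegree_C, totalDegree_X]
    simpa using hN
  · simpa [hp] using hm

theorem exists_generic_mem_isOpen (F : Type) [Field F] [NumberField F] [Algebra F ℝ]
    (N : ℕ) {d : ℕ} {U : Set (Fin d → ℝ)} (hU : IsOpen U) (hne : U.Nonempty) :
    ∃ x ∈ U, (∀ i, IsAlgebraic ℚ (x i)) ∧
      ∀ p : MvPolynomial (Fin d) F, p ≠ 0 → (∀ i, p.degreeOf i ≤ N) → aeval x p ≠ 0 := by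
  obtain ⟨y, hy⟩ := hne
  obtain ⟨ε, hε, hb⟩ := Metric.isOpen_iff.1 hU y hy
  obtain ⟨x, hx, hxa, hxg⟩ := exists_generic_mem_pi_Ioo F N d (fun i => y i - ε)
    (fun i => y i + ε) fun i => by linarith
  refine ⟨x, hb ?_, hxa, hxg⟩
  rw [Metric.mem_ball, dist_pi_lt_iff hε]
  intro i
  rw [Real.dist_eq, abs_lt]
  have := hx i
  constructor <;> linarith [this.1, this.2]

/-- A nonzero exponential polynomial does not vanish identically on an open set. -/
theorem SchanuelConjecture.exists_aeval_exp_ne_zero (hSch : SchanuelConjecture)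
    {F : Type} [Field F] [NumberField F] [Algebra F ℝ] {d : ℕ}
    {p : MvPolynomial (Fin d ⊕ Fin d) F} (hp : p ≠ 0) :
    ∃ x : Fin d → ℝ, aeval (Sum.elim x fun i => Real.exp (x i)) p ≠ 0 := by
  obtain ⟨x, -, hxa, hx⟩ := exists_generic_mem_isOpen F (max p.totalDegree 1) (d := d)
    isOpen_univ univ_nonempty
  exact ⟨x, aeval_sumElim_ne_zero _ x hxa hx _
    (hSch.algebraicIndependent_exp x hxa
      (eq_zero_of_sum_intCast_mul_eq_zero (le_max_right _ _) hx)) p hp (le_max_left _ _)⟩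

namespace MvPolynomial

theorem totalDegree_aeval_le {F σ τ : Type*} [CommRing F] (s : σ → MvPolynomial τ F)
    (hs : ∀ w, (s w).totalDegree ≤ 1) (p : MvPolynomial σ F) :
    (aeval s p).totalDegree ≤ p.totalDegree := by
  rw [aeval_def, eval₂_eq]
  refine totalDegree_finsetSum_le fun m hm => ?_
  refine (totalDegree_mul _ _).trans ?_
  rw [algebraMap_eq, totalDegree_C, zero_add]
  refine (totalDegree_finsetProd _ _).trans ?_
  refine le_trans (Finset.sum_le_sum fun i _ => ?_) (le_totalDegree hm)
  exact (totalDegree_pow _ _).trans (mul_le_of_le_one_right zero_le (hs i))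

theorem totalDegree_hyperplaneSubst_le {F : Type*} [Field F] {d : ℕ} (j : Fin (d + 1))
    (r : Fin d → F) (w : Fin (d + 1)) : (hyperplaneSubst j r w).totalDegree ≤ 1 := by
  rcases eq_or_ne w j with rfl | hw
  · rw [hyperplaneSubst, Fin.insertNth_apply_same]
    refine totalDegree_finsetSum_le fun m _ => ?_
    refine (totalDegree_mul _ _).trans ?_
    simp
  · obtain ⟨i, rfl⟩ := Fin.exists_succAbove_eq hw
    simp [hyperplaneSubst]

theorem nestEquiv_rename_inl {F σ κ : Type*} [CommRing F] (p : MvPolynomial σ F) :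
    nestEquiv F σ κ (rename Sum.inl p) = C p := by
  induction p using MvPolynomial.induction_on with
  | C a => simp [nestEquiv]
  | add p q hp hq => simp only [map_add, hp, hq]
  | mul_X p i hp => simp [hp]

theorem rename_inl_dvd_of_forall_dvd_coeff {F σ κ : Type*} [CommRing F] {T : MvPolynomial σ F}
    {P : MvPolynomial (σ ⊕ κ) F} (h : ∀ a, T ∣ coeff a (nestEquiv F σ κ P)) :
    rename Sum.inl T ∣ P := by
  have h1 := (C_dvd_iff_dvd_coeff T _).2 h
  rw [← nestEquiv_rename_inl] at h1
  exact (map_dvd_iff (nestEquiv F σ κ)).1 h1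

theorem aeval_sumElim_eq_sum {F σ κ : Type*} [CommRing F] [Fintype κ] {A : Type*} [CommRing A]
    [Algebra F A] (x : σ → A) (y : κ → A) (P : MvPolynomial (σ ⊕ κ) F) :
    aeval (Sum.elim x y) P = ∑ a ∈ (nestEquiv F σ κ P).support,
      aeval x (coeff a (nestEquiv F σ κ P)) * ∏ i, y i ^ a i := by
  rw [aeval_sumElim_eq_nestEquiv, eval_map, eval₂_eq']
  rfl

theorem aeval_aeval_hyperplaneSubst {F A : Type*} [Field F] [CommRing A] [Algebra F A] {d : ℕ}
    (j : Fin (d + 1)) (r : Fin d → F) (x : Fin d → A) (p : MvPolynomial (Fin (d + 1)) F) :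
    aeval x (aeval (hyperplaneSubst j r) p) =
      aeval (j.insertNth (∑ i, algebraMap F A (r i) * x i) x : Fin (d + 1) → A) p := by
  have h : (aeval x : _ →ₐ[F] A).comp (aeval (hyperplaneSubst j r)) =
      aeval (j.insertNth (∑ i, algebraMap F A (r i) * x i) x : Fin (d + 1) → A) := by
    refine algHom_ext fun w => ?_
    rcases eq_or_ne w j with rfl | hw
    · simp [hyperplaneSubst]
    · obtain ⟨i, rfl⟩ := Fin.exists_succAbove_eq hw
      simp [hyperplaneSubst]
  exact DFunLike.congr_fun h p

end MvPolynomial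

theorem SchanuelConjecture.exists_sum_intCast_mul_eq_zero (hSch : SchanuelConjecture)
    {F : Type} [Field F] [NumberField F] [Algebra F ℝ] {d : ℕ}
    {P Q : MvPolynomial (Fin (d + 1) ⊕ Fin (d + 1)) F} (hP : Irreducible P) (hPQ : ¬ P ∣ Q) :
    ∃ N : ℕ, ∀ (x : Fin d → ℝ), (∀ i, IsAlgebraic ℚ (x i)) →
      (∀ p : MvPolynomial (Fin d) F, p ≠ 0 → (∀ i, p.degreeOf i ≤ N) → aeval x p ≠ 0) →
      ∀ (j : Fin (d + 1)) (z : Fin (d + 1) → ℝ), (∀ i, z (j.succAbove i) = x i) →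
      aeval (Sum.elim z fun i => Real.exp (z i)) P = 0 →
      aeval (Sum.elim z fun i => Real.exp (z i)) Q = 0 →
      ∃ m : Fin (d + 1) → ℤ, m ≠ 0 ∧ ∑ i, (m i : ℝ) * z i = 0 := by
  choose R hR0 hR using exists_ne_zero_rename_mem_span hP hPQ
  refine ⟨Finset.univ.sup fun v => (R v).totalDegree, fun x hxa hx j z hz hPz hQz => ?_⟩
  by_contra! hcon
  obtain ⟨v, hv, hvi⟩ : ∃ v : Fin (d + 1) → ℝ,
      (∀ i, v i ∈ Set.range z ∪ Set.range fun j => Real.exp (z j)) ∧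
        AlgebraicIndependent ℚ v := by
    by_contra h
    obtain ⟨m, ⟨i, hi⟩, hm⟩ := hSch (d + 1) z h
    exact hcon m (fun h0 => hi (congrFun h0 i)) hm
  set pt : Fin (d + 1) ⊕ Fin (d + 1) → ℝ := Sum.elim z fun i => Real.exp (z i) with hpt
  have h1 : ∀ i, ∃ w, pt w = v i := by
    intro i
    rcases hv i with ⟨l, hl⟩ | ⟨l, hl⟩
    · exact ⟨Sum.inl l, hl⟩
    · exact ⟨Sum.inr l, hl⟩
  choose φ hφ using h1
  set Θ : Fin d ⊕ Fin (d + 1) → Fin (d + 1) ⊕ Fin (d + 1) :=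
    Sum.elim (fun i => Sum.inl (j.succAbove i)) φ with hΘ
  have hΘi : Function.Injective Θ := by
    refine Function.Injective.sumElim (fun a b hab => ?_) (fun a b hab => ?_) fun a b hab => ?_
    · exact Fin.succAbove_right_injective (Sum.inl_injective hab)
    · apply hvi.injective
      rw [← hφ, ← hφ, hab]
    · have h2 := hφ b
      rw [← hab, hpt, Sum.elim_inl, hz] at h2
      exact absurd (h2 ▸ hxa a) (hvi.transcendental b)
  have hΘs : ¬ Function.Surjective Θ := by
    intro h
    have := Fintype.card_le_of_surjective Θ h
    simp at this
  obtain ⟨w, hw⟩ := not_forall.1 hΘs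
  have hΘw : ∀ a, Θ a ≠ w := fun a ha => hw ⟨a, ha⟩
  have hbij : Function.Bijective
      (fun a => ⟨Θ a, hΘw a⟩ : Fin d ⊕ Fin (d + 1) → {u // u ≠ w}) := by
    rw [Fintype.bijective_iff_injective_and_card]
    refine ⟨fun a b hab => hΘi (Subtype.ext_iff.1 hab), ?_⟩
    simp [Fintype.card_subtype_compl]
    omega
  set E := Equiv.ofBijective _ hbij with hE
  have hpE : ∀ u : {u // u ≠ w}, Sum.elim x v (E.symm u) = pt u := by
    intro u
    obtain ⟨a, rfl⟩ := E.surjective u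
    rw [E.symm_apply_apply]
    change _ = pt (Θ a)
    cases a with
    | inl i => simp [hΘ, hpt, hz]
    | inr i => simp [hΘ, hφ]
  refine aeval_sumElim_ne_zero _ x hxa hx v hvi (rename E.symm (R w)) ?_ ?_ ?_
  · exact fun h => hR0 w (rename_injective _ E.symm.injective (by simpa using h))
  · exact (totalDegree_rename_le _ _).trans
      (Finset.le_sup (f := fun v => (R v).totalDegree) (Finset.mem_univ w))
  · rw [aeval_rename]
    have h2 : Sum.elim x v ∘ E.symm = pt ∘ Subtype.val := funext hpE
    rw [h2, ← aeval_rename]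
    obtain ⟨a, b, hab⟩ := Ideal.mem_span_pair.1 (hR w)
    rw [← hab, map_add, map_mul, map_mul, hPz, hQz]
    ring

theorem SchanuelConjecture.exists_pair_of_aeval_eq_zero (hSch : SchanuelConjecture)
    {F : Type} [Field F] [NumberField F] [Algebra F ℝ] {d : ℕ}
    {P Q : MvPolynomial (Fin (d + 1) ⊕ Fin (d + 1)) F} (hP : Irreducible P) (hPQ : ¬ P ∣ Q)
    (j : Fin (d + 1))
    (hT : ∀ r : Fin d → ℚ, ¬ rename Sum.inl (hyperplaneForm j fun i => (r i : F)) ∣ P)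
    {B : Set (Fin d → ℝ)} (hB : IsOpen B) (hBne : B.Nonempty)
    (z : (Fin d → ℝ) → Fin (d + 1) → ℝ) (hz : ∀ x i, z x (j.succAbove i) = x i)
    (hPz : ∀ x ∈ B, aeval (Sum.elim (z x) fun i => Real.exp (z x i)) P = 0)
    (hQz : ∀ x ∈ B, aeval (Sum.elim (z x) fun i => Real.exp (z x i)) Q = 0) :
    ∃ x ∈ B, ∃ a ∈ (nestEquiv F _ _ P).support, ∃ b ∈ (nestEquiv F _ _ P).support, a ≠ b ∧
      ∑ i, ((a i : ℝ) - b i) * z x i = 0 := by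
  obtain ⟨N₁, hN₁⟩ := hSch.exists_sum_intCast_mul_eq_zero hP hPQ
  set S := (nestEquiv F (Fin (d + 1)) (Fin (d + 1)) P).support with hS
  set q : (Fin (d + 1) →₀ ℕ) → MvPolynomial (Fin (d + 1)) F :=
    fun a => coeff a (nestEquiv F (Fin (d + 1)) (Fin (d + 1)) P) with hq
  set N₂ := S.sup fun a => (q a).totalDegree with hN₂
  obtain ⟨x, hxB, hxa, hx⟩ := exists_generic_mem_isOpen F (max N₁ (max N₂ 1)) hB hBne
  have hx₁ : ∀ p : MvPolynomial (Fin d) F, p ≠ 0 → (∀ i, p.degreeOf i ≤ N₁) →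
      aeval x p ≠ 0 := fun p hp h => hx p hp fun i => (h i).trans (le_max_left _ _)
  have hx₂ : ∀ p : MvPolynomial (Fin d) F, p ≠ 0 → (∀ i, p.degreeOf i ≤ N₂) →
      aeval x p ≠ 0 := fun p hp h => hx p hp fun i =>
    (h i).trans ((le_max_left _ _).trans (le_max_right _ _))
  have hlin := eq_zero_of_sum_intCast_mul_eq_zero
    ((le_max_right N₂ 1).trans (le_max_right N₁ _)) hx
  refine ⟨x, hxB, ?_⟩
  by_contra! hcon
  set w := z x with hw
  have hwx : ∀ i, w (j.succAbove i) = x i := hz x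
  obtain ⟨m, hm0, hm⟩ := hN₁ x hxa hx₁ j w hwx (hPz x hxB) (hQz x hxB)
  rw [Fin.sum_univ_succAbove _ j] at hm
  simp only [hwx] at hm
  have hmj : m j ≠ 0 := by
    intro h
    rw [h, Int.cast_zero, zero_mul, zero_add] at hm
    have h1 := hlin (fun i => m (j.succAbove i)) hm
    apply hm0
    funext i
    rcases eq_or_ne i j with rfl | hi
    · exact h
    · obtain ⟨l, rfl⟩ := Fin.exists_succAbove_eq hi
      exact congrFun h1 l
  have hmjR : (m j : ℝ) ≠ 0 := by exact_mod_cast hmj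
  set E : (Fin (d + 1) →₀ ℕ) → Fin d → ℤ :=
    fun a i => m j * a (j.succAbove i) - m (j.succAbove i) * a j with hE
  set ℓ : (Fin (d + 1) →₀ ℕ) → ℝ := fun a => ∑ i, (a i : ℝ) * w i with hℓ
  have hℓE : ∀ a, ℓ a = ∑ i, (E a i : ℝ) * (x i / m j) := by
    intro a
    have h1 : w j = - (∑ i, (m (j.succAbove i) : ℝ) * x i) / m j := by
      field_simp
      linarith
    simp only [hℓ, hE, Fin.sum_univ_succAbove _ j, hwx]
    rw [h1, ← Finset.sum_neg_distrib, Finset.sum_div, Finset.mul_sum, ← Finset.sum_add_distrib]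
    refine Finset.sum_congr rfl fun i _ => ?_
    push_cast
    field_simp
    ring
  set L : ℕ := S.sup fun a => Finset.univ.sup fun i => (E a i).natAbs with hL
  have hEL : ∀ a ∈ S, ∀ i, 0 ≤ E a i + L := by
    intro a ha i
    have h1 : (E a i).natAbs ≤ L :=
      (Finset.le_sup (f := fun i => (E a i).natAbs) (Finset.mem_univ i)).trans
        (Finset.le_sup (f := fun a => Finset.univ.sup fun i => (E a i).natAbs) ha)
    omega
  set D : (Fin (d + 1) →₀ ℕ) → Fin d →₀ ℕ :=
    fun a => Finsupp.equivFunOnFinite.symm fun i => (E a i + L).toNat with hD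
  have hDcast : ∀ a ∈ S, ∀ i, ((D a i : ℕ) : ℝ) = E a i + L := by
    intro a ha i
    have h1 : ((D a i : ℕ) : ℤ) = E a i + L := by
      simp [hD, hEL a ha i]
    exact_mod_cast congrArg (Int.cast : ℤ → ℝ) h1
  have hDinj : ∀ a ∈ S, ∀ b ∈ S, D a = D b → a = b := by
    intro a ha b hb hab
    by_contra hne
    apply hcon a ha b hb hne
    have h1 : ℓ a = ℓ b := by
      rw [hℓE, hℓE]
      refine Finset.sum_congr rfl fun i _ => ?_
      have h2 := hDcast a ha i
      rw [hab, hDcast b hb i] at h2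
      rw [add_right_cancel h2]
    simp only [sub_mul, Finset.sum_sub_distrib]
    exact sub_eq_zero.2 h1
  set r : Fin d → ℚ := fun i => - m (j.succAbove i) / m j with hr
  have hwr : w = j.insertNth (∑ i, algebraMap F ℝ (r i : F) * x i) x := by
    rw [Fin.eq_insertNth_iff]
    refine ⟨?_, funext hwx⟩
    have h1 : w j = - (∑ i, (m (j.succAbove i) : ℝ) * x i) / m j := by
      field_simp
      linarith
    rw [h1, ← Finset.sum_neg_distrib, Finset.sum_div]
    refine Finset.sum_congr rfl fun i _ => ?_
    simp [hr]
    field_simp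
  set s := hyperplaneSubst j fun i => (r i : F) with hs
  have hsq : ∀ p : MvPolynomial (Fin (d + 1)) F, aeval x (aeval s p) = aeval w p := by
    intro p
    rw [hs, aeval_aeval_hyperplaneSubst, ← hwr]
  have hya : AlgebraicIndependent ℚ fun i => Real.exp (x i / m j) := by
    refine hSch.algebraicIndependent_exp _ (fun i => ?_) fun c hc => hlin c ?_
    · rw [div_eq_mul_inv]
      exact (hxa i).mul (isAlgebraic_algebraMap (A := ℝ) (m j : ℚ)).inv
    · have h1 : ∑ i, (c i : ℝ) * x i = (∑ i, (c i : ℝ) * (x i / m j)) * m j := by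
        rw [Finset.sum_mul]
        refine Finset.sum_congr rfl fun i _ => ?_
        field_simp
      rw [h1, hc, zero_mul]
  set G : MvPolynomial (Fin d) (MvPolynomial (Fin d) F) :=
    ∑ a ∈ S, monomial (D a) (aeval s (q a)) with hG
  have hG0 : G = 0 := by
    refine eq_zero_of_eval_map_aeval_eq_zero hxa hx₂ hya G (fun b i => ?_) ?_
    · refine (degreeOf_le_totalDegree _ _).trans ?_
      rw [hG, coeff_sum]
      refine totalDegree_finsetSum_le fun a ha => ?_
      rw [coeff_monomial]
      split_ifs
      · exact (totalDegree_aeval_le _ (totalDegree_hyperplaneSubst_le _ _) _).trans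
          (Finset.le_sup (f := fun a => (q a).totalDegree) ha)
      · simp
    · have h1 : eval (fun i => Real.exp (x i / m j))
          (map (aeval x : MvPolynomial (Fin d) F →ₐ[F] ℝ).toRingHom G) =
          Real.exp (∑ i, L * (x i / m j)) *
            aeval (Sum.elim w fun i => Real.exp (w i)) P := by
        rw [aeval_sumElim_eq_sum, hG, map_sum, map_sum, Finset.mul_sum]
        refine Finset.sum_congr rfl fun a ha => ?_
        rw [map_monomial, eval_monomial, Finsupp.prod_fintype _ _ fun i => pow_zero _]
        have h2 : ∏ i, Real.exp (w i) ^ a i = Real.exp (ℓ a) := by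
          rw [hℓ, Real.exp_sum]
          exact Finset.prod_congr rfl fun i _ => (Real.exp_nat_mul _ _).symm
        have h3 : ∏ i, Real.exp (x i / m j) ^ D a i =
            Real.exp (∑ i, L * (x i / m j)) * Real.exp (ℓ a) := by
          rw [hℓE, ← Real.exp_add, ← Finset.sum_add_distrib, Real.exp_sum]
          refine Finset.prod_congr rfl fun i _ => ?_
          rw [← Real.exp_nat_mul, hDcast a ha]
          congr 1
          ring
        rw [h2, h3]
        change aeval x (aeval s (q a)) * _ = _
        rw [hsq]
        ring
      rw [h1, hPz x hxB, mul_zero]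
  refine hT r (rename_inl_dvd_of_forall_dvd_coeff fun a => ?_)
  by_cases ha : a ∈ S
  · refine dvd_of_aeval_eq_zero s _ (hyperplaneForm_dvd_X_sub j _) ?_
    have h1 : coeff (D a) G = aeval s (q a) := by
      rw [hG, coeff_sum, Finset.sum_eq_single a]
      · simp
      · intro b hb hba
        rw [coeff_monomial, if_neg fun h => hba (hDinj b hb a ha h)]
      · exact fun h => absurd ha h
    rw [← h1, hG0, coeff_zero]
  · rw [notMem_support_iff.1 ha]
    exact dvd_zero _

/-- The point `(x, e^{x})`, with exponentials of the coordinates selected by `e`. -/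
def expPoint {n : ℕ} {κ : Type*} (e : κ → Fin n) (x : Fin n → ℝ) : Fin n ⊕ κ → ℝ :=
  Sum.elim x fun c => Real.exp (x (e c))

theorem SchanuelConjecture.hyperplaneForm_dvd (hSch : SchanuelConjecture)
    {F : Type} [Field F] [NumberField F] [Algebra F ℝ] {d : ℕ} {κ : Type*}
    {e : κ → Fin (d + 1)} (he : Function.Injective e) (c₀ : κ) (r : Fin d → F)
    (R : MvPolynomial {w : Fin (d + 1) ⊕ κ // w ≠ Sum.inr c₀} F)
    (hR : ∀ x : Fin d → ℝ, aeval (fun w : {w : Fin (d + 1) ⊕ κ // w ≠ Sum.inr c₀} =>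
      expPoint e ((e c₀).insertNth (∑ i, algebraMap F ℝ (r i) * x i) x) w) R = 0) :
    rename (fun i => ⟨Sum.inl i, Sum.inl_ne_inr⟩) (hyperplaneForm (e c₀) r) ∣ R := by
  set j := e c₀ with hj
  have h1 : ∀ c : {c // c ≠ c₀}, ∃ i : Fin d, j.succAbove i = e c := fun c =>
    Fin.exists_succAbove_eq fun h => c.2 (he h)
  choose f hf using h1
  have hfi : Function.Injective f := by
    intro a b hab
    apply Subtype.ext
    apply he
    rw [← hf, ← hf, hab]
  let s : {w : Fin (d + 1) ⊕ κ // w ≠ Sum.inr c₀} → MvPolynomial (Fin d ⊕ Fin d) F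
    | ⟨Sum.inl i, _⟩ => rename Sum.inl (hyperplaneSubst j r i)
    | ⟨Sum.inr c, hc⟩ => X (Sum.inr (f ⟨c, fun h => hc (congrArg Sum.inr h)⟩))
  let ι : Fin d ⊕ Fin d → {w : Fin (d + 1) ⊕ κ // w ≠ Sum.inr c₀} :=
    Sum.elim (fun i => ⟨Sum.inl (j.succAbove i), Sum.inl_ne_inr⟩)
      (Function.extend f (fun c => ⟨Sum.inr c, fun h => c.2 (Sum.inr_injective h)⟩)
        fun _ => ⟨Sum.inl j, Sum.inl_ne_inr⟩)
  refine dvd_of_aeval_eq_zero s ι ?_ ?_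
  · rintro ⟨i | c, hw⟩
    · have h2 : (X ⟨Sum.inl i, hw⟩ - rename ι (s ⟨Sum.inl i, hw⟩) :
          MvPolynomial {w : Fin (d + 1) ⊕ κ // w ≠ Sum.inr c₀} F) =
          rename (fun i => (⟨Sum.inl i, Sum.inl_ne_inr⟩ :
            {w : Fin (d + 1) ⊕ κ // w ≠ Sum.inr c₀}))
            (X i - rename j.succAbove (hyperplaneSubst j r i)) := by
        rw [map_sub, rename_X, rename_rename, rename_rename]
        rfl
      rw [h2]
      exact map_dvd _ (hyperplaneForm_dvd_X_sub j r i)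
    · have h2 : (rename ι (s ⟨Sum.inr c, hw⟩) :
          MvPolynomial {w : Fin (d + 1) ⊕ κ // w ≠ Sum.inr c₀} F) = X ⟨Sum.inr c, hw⟩ := by
        change rename ι (X _) = _
        rw [rename_X]
        congr 1
        exact hfi.extend_apply (fun c => (⟨Sum.inr c, fun h => c.2 (Sum.inr_injective h)⟩ :
          {w : Fin (d + 1) ⊕ κ // w ≠ Sum.inr c₀})) (fun _ => ⟨Sum.inl j, Sum.inl_ne_inr⟩)
          (⟨c, fun h => hw (congrArg Sum.inr h)⟩ : {c // c ≠ c₀})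
      rw [h2, sub_self]
      exact dvd_zero _
  · by_contra hne
    obtain ⟨x, hx⟩ := hSch.exists_aeval_exp_ne_zero hne
    apply hx
    rw [← hR x]
    have h3 : (aeval (Sum.elim x fun i => Real.exp (x i)) :
        MvPolynomial (Fin d ⊕ Fin d) F →ₐ[F] ℝ).comp (aeval s) =
        aeval (fun w : {w : Fin (d + 1) ⊕ κ // w ≠ Sum.inr c₀} =>
          expPoint e (j.insertNth (∑ i, algebraMap F ℝ (r i) * x i) x) w) := by
      refine algHom_ext ?_
      rintro ⟨i | c, hw⟩
      · simp only [AlgHom.comp_apply, aeval_X]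
        change aeval _ (rename Sum.inl (hyperplaneSubst j r i)) =
          Fin.insertNth (α := fun _ => ℝ) j _ x i
        rw [aeval_rename, Sum.elim_comp_inl]
        have := aeval_aeval_hyperplaneSubst j r x (X i)
        rwa [aeval_X, aeval_X] at this
      · simp only [AlgHom.comp_apply, aeval_X]
        change aeval _ (X _) = Real.exp (Fin.insertNth (α := fun _ => ℝ) j _ x (e c))
        rw [aeval_X, Sum.elim_inr, ← hf ⟨c, fun h => hw (congrArg Sum.inr h)⟩,
          Fin.insertNth_apply_succAbove]
    exact DFunLike.congr_fun h3 R

theorem exists_graph {d : ℕ} {h : (Fin (d + 1) → ℝ) → ℝ} {q : Fin (d + 1) → ℝ}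
    (hh : AnalyticAt ℝ h q) (hq : h q = 0) (i : Fin (d + 1))
    (hi : fderiv ℝ h q (Pi.single i 1) ≠ 0) :
    ∃ ε > 0, ∃ g : (Fin d → ℝ) → ℝ, AnalyticOnNhd ℝ g (Metric.ball (i.removeNth q) ε) ∧
      g (i.removeNth q) = q i ∧
      (∀ x ∈ Metric.ball (i.removeNth q) ε, h (i.insertNth (g x) x) = 0) ∧
      ∀ᶠ y in nhds q, h y = 0 → y i = g (i.removeNth y) := by
  set L : (Fin d → ℝ) × ℝ →L[ℝ] (Fin (d + 1) → ℝ) :=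
    ContinuousLinearMap.pi (i.insertNth (α := fun _ => (Fin d → ℝ) × ℝ →L[ℝ] ℝ)
      (ContinuousLinearMap.snd ℝ _ _)
      fun c => (ContinuousLinearMap.proj c).comp (ContinuousLinearMap.fst ℝ _ _)) with hL
  have hLapply : ∀ p, L p = i.insertNth (α := fun _ => ℝ) p.2 p.1 := by
    intro p
    refine (Fin.eq_insertNth_iff (α := fun _ => ℝ)).2 ⟨by simp [hL], ?_⟩
    ext c
    simp [hL, Fin.removeNth]
  set u : (Fin d → ℝ) × ℝ := (i.removeNth q, q i) with hu
  have hLu : L u = q := by rw [hLapply]; exact Fin.insertNth_self_removeNth i q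
  have hLinr : L.comp (ContinuousLinearMap.inr ℝ (Fin d → ℝ) ℝ) =
      ContinuousLinearMap.toSpanSingleton ℝ (Pi.single i 1 : Fin (d + 1) → ℝ) := by
    refine ContinuousLinearMap.ext_ring ?_
    simp only [ContinuousLinearMap.comp_apply, ContinuousLinearMap.inr_apply, hLapply,
      ContinuousLinearMap.toSpanSingleton_apply, one_smul]
    refine ((Fin.eq_insertNth_iff (α := fun _ => ℝ)).2 ⟨by simp, ?_⟩).symm
    ext c
    simp [Fin.removeNth]
  have hf : AnalyticAt ℝ (h ∘ L) u := AnalyticAt.comp (by rwa [hLu]) (L.analyticAt u)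
  have cdf : ContDiffAt ℝ ⊤ (h ∘ L) u := hf.contDiffAt
  have hfd : (fderiv ℝ (h ∘ L) u).comp (ContinuousLinearMap.inr ℝ (Fin d → ℝ) ℝ) =
      (fderiv ℝ h q).comp (ContinuousLinearMap.toSpanSingleton ℝ (Pi.single i 1)) := by
    rw [fderiv_comp u (by rw [hLu]; exact hh.differentiableAt) L.differentiableAt, hLu,
      ContinuousLinearMap.fderiv, ContinuousLinearMap.comp_assoc, hLinr]
  have hinv : ((fderiv ℝ (h ∘ L) u).comp
      (ContinuousLinearMap.inr ℝ (Fin d → ℝ) ℝ)).IsInvertible := by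
    refine ⟨ContinuousLinearEquiv.unitsEquivAut ℝ (Units.mk0 _ hi), ?_⟩
    rw [hfd]
    refine ContinuousLinearMap.ext_ring ?_
    simp
  have hfu : (h ∘ L) u = 0 := by simp [hLu, hq]
  set g := cdf.implicitFunction (by simp) hinv with hg
  have hgan : AnalyticAt ℝ g u.1 := (cdf.contDiffAt_implicitFunction (by simp) hinv).analyticAt
  obtain ⟨ε, hε, hεb⟩ := Metric.eventually_nhds_iff_ball.1 (hgan.eventually_analyticAt.and
    (cdf.eventually_apply_implicitFunction (by simp) hinv))
  refine ⟨ε, hε, g, fun x hx => (hεb x hx).1,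
    cdf.implicitFunction_apply_self (by simp) hinv, fun x hx => ?_, ?_⟩
  · have := (hεb x hx).2
    rwa [hfu, Function.comp_apply, hLapply] at this
  · have hev := cdf.eventually_apply_eq_iff_implicitFunction (by simp) hinv
    have hcont : Filter.Tendsto (fun y : Fin (d + 1) → ℝ => (i.removeNth y, y i))
        (nhds q) (nhds u) := by
      refine Continuous.tendsto' ?_ _ _ rfl
      exact (continuous_pi fun c => continuous_apply _).prodMk (continuous_apply i)
    filter_upwards [hcont.eventually hev] with y hy hy0
    rw [hfu, Function.comp_apply, hLapply] at hy
    have : i.insertNth (α := fun _ => ℝ) (y i) (i.removeNth y) = y :=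
      Fin.insertNth_self_removeNth i y
    exact (hy.1 (by rw [this]; exact hy0)).symm

theorem exists_iteratedFDeriv_ne_zero {E : Type*} [NormedAddCommGroup E] [NormedSpace ℝ E]
    {f : E → ℝ} {U : Set E} (hf : AnalyticOnNhd ℝ f U) (hU : IsPreconnected U)
    (hne : ∃ x ∈ U, f x ≠ 0) {z : E} (hz : z ∈ U) : ∃ n, iteratedFDeriv ℝ n f z ≠ 0 := by
  by_contra! hall
  obtain ⟨x, hx, hfx⟩ := hne
  refine hfx (hf.eqOn_zero_of_preconnected_of_eventuallyEq_zero hU hz ?_ hx)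
  obtain ⟨p, r, hp⟩ := hf z hz
  have hev : ∀ᶠ y in nhds z, y ∈ Metric.eball z r := Metric.eball_mem_nhds z hp.r_pos
  filter_upwards [hev] with y hy
  have := hp.hasSum_iteratedFDeriv (y := y - z)
    (by simpa [edist_eq_enorm_sub] using hy)
  rw [add_sub_cancel] at this
  refine this.unique ?_
  simp [hall]

/-- At a zero of a nonzero analytic function, some iterated partial derivative vanishes while one
of its partial derivatives does not. -/
theorem exists_iteratedFDeriv_tail {m : ℕ} {f : (Fin m → ℝ) → ℝ} {U : Set (Fin m → ℝ)}
    (hf : AnalyticOnNhd ℝ f U) (hU : IsPreconnected U)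
    (hne : ∃ x ∈ U, f x ≠ 0) {z : Fin m → ℝ} (hz : z ∈ U) (hfz : f z = 0) :
    ∃ (n : ℕ) (v : Fin n → Fin m) (i : Fin m),
      iteratedFDeriv ℝ n f z (fun c => Pi.single (v c) 1) = 0 ∧
      fderiv ℝ (fun y => iteratedFDeriv ℝ n f y (fun c => Pi.single (v c) 1)) z
        (Pi.single i 1) ≠ 0 := by
  classical
  have hex := exists_iteratedFDeriv_ne_zero hf hU hne hz
  set N := Nat.find hex with hN
  have hNne : iteratedFDeriv ℝ N f z ≠ 0 := Nat.find_spec hex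
  have hlt : ∀ n < N, iteratedFDeriv ℝ n f z = 0 := fun n hn => not_not.1 (Nat.find_min hex hn)
  rcases hNeq : N with _ | n
  · rw [hNeq] at hNne
    refine absurd ?_ hNne
    ext v
    simpa using hfz
  rw [hNeq] at hNne
  obtain ⟨v, hv⟩ : ∃ v : Fin (n + 1) → Fin m,
      iteratedFDeriv ℝ (n + 1) f z (fun c => Pi.single (v c) 1) ≠ 0 := by
    by_contra! hall
    apply hNne
    apply ContinuousMultilinearMap.toMultilinearMap_injective
    refine Module.Basis.ext_multilinear (fun _ => Pi.basisFun ℝ (Fin m)) fun v => ?_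
    simpa using hall v
  refine ⟨n, Fin.tail v, v 0, by rw [hlt n (by omega)]; simp, ?_⟩
  rw [iteratedFDeriv_succ_apply_left] at hv
  have hd : DifferentiableAt ℝ (iteratedFDeriv ℝ n f) z :=
    (hf.iteratedFDeriv n z hz).differentiableAt
  have := ((ContinuousMultilinearMap.apply ℝ (fun _ : Fin n => Fin m → ℝ) ℝ
    (fun c => Pi.single (Fin.tail v c) 1)).hasFDerivAt.comp z hd.hasFDerivAt).fderiv
  rw [show (fun y => iteratedFDeriv ℝ n f y (fun c => Pi.single (Fin.tail v c) 1)) =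
    (ContinuousMultilinearMap.apply ℝ (fun _ : Fin n => Fin m → ℝ) ℝ
    (fun c => Pi.single (Fin.tail v c) 1)) ∘ iteratedFDeriv ℝ n f from rfl, this]
  exact hv

/-- To bound the dimension of a set of zeros of a nonzero analytic function, it suffices to bound
the dimension of its traces on analytic graphs. -/
theorem dimH_le_of_graphs {m : ℕ} {f : (Fin (m + 1) → ℝ) → ℝ} {U : Set (Fin (m + 1) → ℝ)}
    (hf : AnalyticOnNhd ℝ f U) (hU : IsPreconnected U)
    (hne : ∃ x ∈ U, f x ≠ 0) {A : Set (Fin (m + 1) → ℝ)} (hAU : A ⊆ U)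
    (hA : ∀ z ∈ A, f z = 0) (r : ℝ≥0∞)
    (hr : ∀ (i : Fin (m + 1)) (c : Fin m → ℝ) (ε : ℝ) (g : (Fin m → ℝ) → ℝ), 0 < ε →
      AnalyticOnNhd ℝ g (Metric.ball c ε) →
      dimH {x | x ∈ Metric.ball c ε ∧ i.insertNth (α := fun _ => ℝ) (g x) x ∈ A} ≤ r) :
    dimH A ≤ r := by
  set S : (Σ n, (Fin n → Fin (m + 1))) × Fin (m + 1) → Set (Fin (m + 1) → ℝ) := fun a =>
    {z | z ∈ A ∧ iteratedFDeriv ℝ a.1.1 f z (fun c => Pi.single (a.1.2 c) 1) = 0 ∧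
      fderiv ℝ (fun y => iteratedFDeriv ℝ a.1.1 f y (fun c => Pi.single (a.1.2 c) 1)) z
        (Pi.single a.2 1) ≠ 0} with hS
  have hcov : A ⊆ ⋃ a, S a := by
    intro z hz
    obtain ⟨n, v, i, h1, h2⟩ := exists_iteratedFDeriv_tail hf hU hne (hAU hz) (hA z hz)
    exact Set.mem_iUnion.2 ⟨(⟨n, v⟩, i), hz, h1, h2⟩
  refine (dimH_mono hcov).trans ?_
  rw [dimH_iUnion]
  refine iSup_le ?_
  rintro ⟨⟨n, v⟩, i⟩
  by_contra! hlt
  obtain ⟨z, ⟨hzA, hz0, hzd⟩, hzt⟩ := exists_mem_nhdsWithin_lt_dimH_of_lt_dimH hlt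
  have han : AnalyticAt ℝ
      (fun y => iteratedFDeriv ℝ n f y (fun c => Pi.single (v c) (1 : ℝ))) z :=
    (ContinuousLinearMap.analyticAt (ContinuousMultilinearMap.apply ℝ
      (fun _ : Fin n => Fin (m + 1) → ℝ) ℝ (fun c => Pi.single (v c) 1)) _).comp
      (hf.iteratedFDeriv n z (hAU hzA))
  obtain ⟨ε, hε, g, hg, hgz, -, hev⟩ := exists_graph han hz0 i hzd
  have hrem : ∀ᶠ y in nhds z,
      i.removeNth (α := fun _ => ℝ) y ∈ Metric.ball (i.removeNth (α := fun _ => ℝ) z) ε :=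
    (Continuous.tendsto' (continuous_pi fun c => continuous_apply _) _ _ rfl :
      Filter.Tendsto (fun y : Fin (m + 1) → ℝ => i.removeNth y) (nhds z)
        (nhds (i.removeNth z))).eventually (Metric.ball_mem_nhds _ hε)
  have hmem : {y | y ∈ S (⟨n, v⟩, i) ∧ y i = g (i.removeNth y) ∧
      i.removeNth (α := fun _ => ℝ) y ∈ Metric.ball (i.removeNth (α := fun _ => ℝ) z) ε} ∈
        nhdsWithin z (S (⟨n, v⟩, i)) := by
    filter_upwards [self_mem_nhdsWithin, hev.filter_mono nhdsWithin_le_nhds,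
      hrem.filter_mono nhdsWithin_le_nhds] with y hy h1 h2
    exact ⟨hy, h1 hy.2.1, h2⟩
  refine absurd (hzt _ hmem) (not_lt.2 ?_)
  set G : (Fin m → ℝ) → Fin (m + 1) → ℝ := fun x => i.insertNth (α := fun _ => ℝ) (g x) x with hG
  have hGc : ContDiffOn ℝ 1 G (Metric.ball (i.removeNth z) ε) := by
    rw [contDiffOn_pi]
    intro c
    refine Fin.succAboveCases i ?_ (fun c => ?_) c
    · simpa [hG] using (hg.analyticOn.contDiffOn Metric.isOpen_ball.uniqueDiffOn : ContDiffOn ℝ 1 g _)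
    · simp only [hG, Fin.insertNth_apply_succAbove]
      exact (contDiff_apply ℝ ℝ c).contDiffOn
  calc dimH _ ≤ dimH (G '' {x : Fin m → ℝ | x ∈ Metric.ball (i.removeNth (α := fun _ => ℝ) z) ε ∧
        i.insertNth (α := fun _ => ℝ) (g x) x ∈ A}) := by
        refine dimH_mono ?_
        rintro y ⟨hyS, hy1, hy2⟩
        have : G (i.removeNth y) = y := by
          simp only [hG, ← hy1]
          exact Fin.insertNth_self_removeNth i y
        refine ⟨i.removeNth y, ⟨hy2, ?_⟩, this⟩
        change G (i.removeNth y) ∈ A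
        rw [this]
        exact hyS.1
    _ ≤ _ := hGc.dimH_image_le (convex_ball _ _) fun x hx => hx.1
    _ ≤ r := hr _ _ _ _ hε hg

theorem dimH_zeros_le {m : ℕ} {f : (Fin (m + 1) → ℝ) → ℝ} {U : Set (Fin (m + 1) → ℝ)}
    (hf : AnalyticOnNhd ℝ f U) (hU : IsPreconnected U) (hne : ∃ x ∈ U, f x ≠ 0) :
    dimH {x | x ∈ U ∧ f x = 0} ≤ m := by
  refine dimH_le_of_graphs hf hU hne (fun x hx => hx.1) (fun x hx => hx.2) _ ?_
  intro i c ε g _ _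
  exact (dimH_mono (Set.subset_univ _)).trans (Real.dimH_univ_pi_fin m).le

/-- A codimension-one zero set of an analytic function contains an analytic graph. -/
theorem exists_graph_of_dimH {d : ℕ} {f : (Fin (d + 1) → ℝ) → ℝ}
    (hf : AnalyticOnNhd ℝ f Set.univ) (hne : ∃ x, f x ≠ 0) (hz : ∃ x, f x = 0)
    (hdim : dimH {x | f x = 0} = d) :
    ∃ (j : Fin (d + 1)) (c : Fin d → ℝ) (ε : ℝ) (g : (Fin d → ℝ) → ℝ), 0 < ε ∧
      AnalyticOnNhd ℝ g (Metric.ball c ε) ∧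
      ∀ x ∈ Metric.ball c ε, f (j.insertNth (g x) x) = 0 := by
  rcases d with _ | m
  · obtain ⟨x, hx⟩ := hz
    refine ⟨0, 0, 1, fun _ => x 0, one_pos, analyticOnNhd_const, fun y _ => ?_⟩
    convert hx
    ext i
    rw [Fin.fin_one_eq_zero i, Fin.insertNth_apply_same]
  · by_contra! hcon
    have hle : dimH {x | f x = 0} ≤ m := by
      refine dimH_le_of_graphs hf isPreconnected_univ (by simpa using hne) (Set.subset_univ _)
        (fun x hx => hx) _ ?_
      intro i c ε g hε hg
      obtain ⟨x, hx, hfx⟩ := hcon i c ε g hε hg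
      refine dimH_zeros_le (f := fun x => f (i.insertNth (g x) x)) ?_
        (convex_ball c ε).isPreconnected ⟨x, hx, hfx⟩
      refine AnalyticOnNhd.comp (t := Set.univ) hf (AnalyticOnNhd.pi fun a => ?_)
        (fun _ _ => Set.mem_univ _)
      refine Fin.succAboveCases i ?_ (fun a => ?_) a
      · simpa using hg
      · simp only [Fin.insertNth_apply_succAbove]
        exact (ContinuousLinearMap.proj (R := ℝ) (φ := fun _ : Fin (m + 1) => ℝ) a).analyticOnNhd _
    rw [hdim] at hle
    have : m + 1 ≤ m := by exact_mod_cast hle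
    omega

section Derivation

variable {F : Type*} [Field F] [Algebra F ℝ] {n : ℕ} {κ : Type*}

theorem analyticAt_aeval_expPoint {E : Type*} [NormedAddCommGroup E] [NormedSpace ℝ E]
    (e : κ → Fin n) {z : E → Fin n → ℝ} {x : E} (hz : ∀ i, AnalyticAt ℝ (fun y => z y i) x)
    (P : MvPolynomial (Fin n ⊕ κ) F) :
    AnalyticAt ℝ (fun y => aeval (expPoint e (z y)) P) x := by
  refine AnalyticAt.aeval_mvPolynomial ?_ P
  rintro (i | c)
  · exact hz i
  · exact (hz (e c)).rexp

theorem analyticOnNhd_aeval_expPoint (e : κ → Fin n) (P : MvPolynomial (Fin n ⊕ κ) F) :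
    AnalyticOnNhd ℝ (fun x => aeval (expPoint e x) P) Set.univ := fun _ _ =>
  analyticAt_aeval_expPoint e (z := fun y => y)
    (fun i => (ContinuousLinearMap.proj (R := ℝ) (φ := fun _ : Fin n => ℝ) i).analyticAt _) P

/-- The derivation of `F[X, U]` inducing `∂/∂xᵢ` on exponential polynomials. -/
def expDeriv (F : Type*) [Field F] (e : κ → Fin n) (i : Fin n) :
    Derivation F (MvPolynomial (Fin n ⊕ κ) F) (MvPolynomial (Fin n ⊕ κ) F) :=
  mkDerivation F (Sum.elim (fun a => if a = i then 1 else 0)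
    fun c => if e c = i then X (Sum.inr c) else 0)

theorem hasFDerivAt_aeval_expPoint (e : κ → Fin n) (P : MvPolynomial (Fin n ⊕ κ) F)
    (x : Fin n → ℝ) :
    HasFDerivAt (fun x => aeval (expPoint e x) P)
      (∑ i, aeval (expPoint e x) (expDeriv F e i P) •
        ContinuousLinearMap.proj (R := ℝ) (φ := fun _ : Fin n => ℝ) i) x := by
  induction P using MvPolynomial.induction_on with
  | C a => simpa using hasFDerivAt_const (algebraMap F ℝ a) x
  | add p q hp hq =>
    simp only [map_add]
    refine (hp.add hq).congr_fderiv ?_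
    simp [add_smul, Finset.sum_add_distrib]
  | mul_X p w hp =>
    have hw : HasFDerivAt (fun x : Fin n → ℝ => expPoint e x w)
        (∑ i, aeval (expPoint e x) (expDeriv F e i (X w)) •
        ContinuousLinearMap.proj (R := ℝ) (φ := fun _ : Fin n => ℝ) i) x := by
      rcases w with a | c
      · refine HasFDerivAt.congr_fderiv (hasFDerivAt_apply (𝕜 := ℝ) a x) ?_
        ext v
        simp [expDeriv, mkDerivation_X, apply_ite]
      · refine HasFDerivAt.congr_fderiv (hasFDerivAt_apply (𝕜 := ℝ) (e c) x).exp ?_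
        ext v
        simp [expDeriv, mkDerivation_X, apply_ite, expPoint]
    simp only [map_mul, aeval_X]
    refine (hp.mul hw).congr_fderiv ?_
    ext v
    simp [Derivation.leibniz, Finset.mul_sum, add_mul, Finset.sum_add_distrib, mul_assoc]

/-- An exponential polynomial which divides all its partial derivatives has no zero, unless it
vanishes identically. -/
theorem aeval_expPoint_eq_zero_of_dvd (e : κ → Fin n) (P : MvPolynomial (Fin n ⊕ κ) F)
    (hP : ∀ i, P ∣ expDeriv F e i P) {q : Fin n → ℝ} (hq : aeval (expPoint e q) P = 0)
    (y : Fin n → ℝ) : aeval (expPoint e y) P = 0 := by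
  choose M hM using hP
  set γ : ℝ → Fin n → ℝ := fun t => q + t • (y - q) with hγ
  have hγc : Continuous γ := by fun_prop
  have hγd : ∀ t, HasDerivAt γ (y - q) t := fun t =>
    (((hasDerivAt_id t).smul_const (y - q)).const_add q).congr_deriv (one_smul _ _)
  set μ : ℝ → ℝ := fun t => ∑ i, aeval (expPoint e (γ t)) (M i) * (y - q) i with hμ
  have hμc : Continuous μ := by
    refine continuous_finsetSum _ fun i _ => Continuous.mul ?_ continuous_const
    exact ((analyticOnNhd_aeval_expPoint e (M i)).continuousOn.mono
      (Set.subset_univ _)).comp_continuous hγc fun _ => Set.mem_univ _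
  have hd : ∀ t, HasDerivAt (fun t => aeval (expPoint e (γ t)) P)
      (μ t * aeval (expPoint e (γ t)) P) t := by
    intro t
    refine ((hasFDerivAt_aeval_expPoint e P (γ t)).comp_hasDerivAt t (hγd t)).congr_deriv ?_
    simp only [hM, map_mul, hμ, Finset.sum_mul, sum_apply,
      smul_apply, ContinuousLinearMap.proj_apply, smul_eq_mul]
    exact Finset.sum_congr rfl fun i _ => by ring
  obtain ⟨C, hC⟩ := isCompact_Icc.exists_bound_of_continuousOn (s := Set.Icc (0 : ℝ) 1)
    hμc.continuousOn
  have := eq_zero_of_abs_deriv_le_mul_abs_self_of_eq_zero_right (K := C) (a := 0) (b := 1)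
    (f := fun t => aeval (expPoint e (γ t)) P)
    (fun t _ => (hd t).continuousAt.continuousWithinAt)
    (fun t _ => (hd t).hasDerivWithinAt) (by simpa [hγ] using hq)
    (fun t ht => by
      rw [norm_mul]
      exact mul_le_mul_of_nonneg_right (hC t (Set.Ico_subset_Icc_self ht)) (norm_nonneg _))
    1 (by simp)
  simpa [hγ] using this

end Derivation

/-- If finitely many continuous functions have a common zero-set product dense in an open set,
one of them vanishes on a nonempty open subset. -/
theorem exists_isOpen_forall_eq_zero {X ι : Type*} [TopologicalSpace X] (s : Finset ι)
    (h : ι → X → ℝ) {B : Set X} (hB : IsOpen B) (hne : B.Nonempty)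
    (hc : ∀ i ∈ s, ContinuousOn (h i) B)
    (hz : ∀ B' ⊆ B, IsOpen B' → B'.Nonempty → ∃ x ∈ B', ∃ i ∈ s, h i x = 0) :
    ∃ i ∈ s, ∃ B' ⊆ B, IsOpen B' ∧ B'.Nonempty ∧ ∀ x ∈ B', h i x = 0 := by
  classical
  induction s using Finset.induction_on generalizing B with
  | empty => simpa using hz B subset_rfl hB hne
  | insert a s _ ih =>
    by_cases ha : ∀ x ∈ B, h a x = 0
    · exact ⟨a, by simp, B, subset_rfl, hB, hne, ha⟩
    · push Not at ha
      obtain ⟨x, hx, hax⟩ := ha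
      obtain ⟨i, hi, B', h1, h2, h3, h4⟩ := ih (B := B ∩ h a ⁻¹' {0}ᶜ)
        ((hc a (by simp)).isOpen_inter_preimage hB isOpen_compl_singleton) ⟨x, hx, hax⟩
        (fun i hi => (hc i (by simp [hi])).mono Set.inter_subset_left)
        (fun B' hB' ho hn => by
          obtain ⟨y, hy, i, hi, hiy⟩ := hz B' (hB'.trans Set.inter_subset_left) ho hn
          rcases Finset.mem_insert.1 hi with rfl | hi
          · exact absurd hiy (hB' hy).2
          · exact ⟨y, hy, i, hi, hiy⟩)
      exact ⟨i, by simp [hi], B', h1.trans Set.inter_subset_left, h2, h3, h4⟩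

theorem eq_zero_of_mul_eq_zero_of_analyticOnNhd {E : Type*} [NormedAddCommGroup E]
    [NormedSpace ℝ E] {f g : E → ℝ} (hf : AnalyticOnNhd ℝ f Set.univ)
    (hg : AnalyticOnNhd ℝ g Set.univ) (hfg : ∀ x, f x * g x = 0) :
    (∀ x, f x = 0) ∨ ∀ x, g x = 0 := by
  by_contra! hcon
  obtain ⟨⟨x, hx⟩, y, hy⟩ := hcon
  refine hy (hg.eqOn_zero_of_preconnected_of_eventuallyEq_zero isPreconnected_univ
    (Set.mem_univ x) ?_ (Set.mem_univ y))
  filter_upwards [(hf x (Set.mem_univ x)).continuousAt.eventually_ne hx] with z hz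
  exact (mul_eq_zero.1 (hfg z)).resolve_left hz

theorem eq_zero_of_sum_mul_eq_zero_of_isOpen {d : ℕ} {a : Fin d → ℝ} {B : Set (Fin d → ℝ)}
    (hB : IsOpen B) (hne : B.Nonempty) (h : ∀ x ∈ B, ∑ i, a i * x i = 0) : a = 0 := by
  obtain ⟨x, hx⟩ := hne
  ext i
  have hev : ∀ᶠ t in nhds (0 : ℝ), x + t • Pi.single i (1 : ℝ) ∈ B := by
    have hc : Continuous fun t : ℝ => x + t • Pi.single (M := fun _ => ℝ) i (1 : ℝ) := by fun_prop
    exact hc.continuousAt.eventually (hB.mem_nhds (by simpa using hx))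
  obtain ⟨ε, hε, hb⟩ := Metric.eventually_nhds_iff.1 hev
  have h1 := h _ (hb (y := ε / 2) (by simp [abs_of_pos hε, hε]))
  simp only [Pi.add_apply, Pi.smul_apply, smul_eq_mul, mul_add, Finset.sum_add_distrib, h x hx,
    Pi.single_apply] at h1
  simpa [hε.ne'] using h1

section Hyperplane

variable {F : Type*} [Field F] [Algebra F ℝ] {d : ℕ} {κ : Type*}

/-- The parametrization of the hyperplane defined by `hyperplaneForm`. -/
def hyperplanePoint (j : Fin (d + 1)) (r : Fin d → F) (x : Fin d → ℝ) : Fin (d + 1) → ℝ :=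
  j.insertNth (∑ i, algebraMap F ℝ (r i) * x i) x

theorem aeval_expPoint_hyperplaneForm (e : κ → Fin (d + 1)) (j : Fin (d + 1)) (r : Fin d → F)
    (z : Fin (d + 1) → ℝ) : aeval (expPoint e z) (rename Sum.inl (hyperplaneForm j r)) =
      z j - ∑ i, algebraMap F ℝ (r i) * z (j.succAbove i) := by
  rw [aeval_rename]
  simp [hyperplaneForm, expPoint]

theorem mem_range_hyperplanePoint {e : κ → Fin (d + 1)} {j : Fin (d + 1)} {r : Fin d → F}
    {z : Fin (d + 1) → ℝ} : z ∈ Set.range (hyperplanePoint j r) ↔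
      aeval (expPoint e z) (rename Sum.inl (hyperplaneForm j r)) = 0 := by
  rw [aeval_expPoint_hyperplaneForm, sub_eq_zero]
  constructor
  · rintro ⟨x, rfl⟩
    simp [hyperplanePoint]
  · intro h
    refine ⟨j.removeNth z, ?_⟩
    rw [hyperplanePoint]
    simp only [Fin.removeNth, ← h]
    exact Fin.insertNth_self_removeNth j z

theorem analyticOnNhd_aeval_hyperplanePoint (e : κ → Fin (d + 1)) (j : Fin (d + 1))
    (r : Fin d → F) (P : MvPolynomial (Fin (d + 1) ⊕ κ) F) :
    AnalyticOnNhd ℝ (fun x => aeval (expPoint e (hyperplanePoint j r x)) P) Set.univ := by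
  intro x _
  have hp : ∀ i, AnalyticAt ℝ (fun y : Fin d → ℝ => y i) x := fun i =>
    (ContinuousLinearMap.proj (R := ℝ) (φ := fun _ : Fin d => ℝ) i).analyticAt _
  refine analyticAt_aeval_expPoint e (fun i => ?_) P
  refine Fin.succAboveCases j ?_ (fun i => ?_) i
  · simp only [hyperplanePoint, Fin.insertNth_apply_same]
    exact Finset.analyticAt_fun_sum _ fun i _ => analyticAt_const.mul (hp i)
  · simpa [hyperplanePoint] using hp i

end Hyperplane

section VanishingIdeal

variable {F : Type*} [Field F] [Algebra F ℝ] {n d : ℕ} {κ : Type*}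

variable (F) in
/-- The ideal of polynomials whose exponential polynomial vanishes on `V`. -/
def expVanishingIdeal (e : κ → Fin n) (V : Set (Fin n → ℝ)) :
    Ideal (MvPolynomial (Fin n ⊕ κ) F) :=
  ⨅ x ∈ V, RingHom.ker (aeval (R := F) (expPoint e x))

theorem mem_expVanishingIdeal {e : κ → Fin n} {V : Set (Fin n → ℝ)}
    {Q : MvPolynomial (Fin n ⊕ κ) F} :
    Q ∈ expVanishingIdeal F e V ↔ ∀ x ∈ V, aeval (expPoint e x) Q = 0 := by
  simp [expVanishingIdeal, RingHom.mem_ker]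

theorem mem_or_mem_expVanishingIdeal_hyperplane (e : κ → Fin (d + 1)) (j : Fin (d + 1))
    (r : Fin d → F) {Q₁ Q₂ : MvPolynomial (Fin (d + 1) ⊕ κ) F}
    (h : Q₁ * Q₂ ∈ expVanishingIdeal F e (Set.range (hyperplanePoint j r))) :
    Q₁ ∈ expVanishingIdeal F e (Set.range (hyperplanePoint j r)) ∨
      Q₂ ∈ expVanishingIdeal F e (Set.range (hyperplanePoint j r)) := by
  simp only [mem_expVanishingIdeal, Set.forall_mem_range, map_mul] at h ⊢
  exact eq_zero_of_mul_eq_zero_of_analyticOnNhd (analyticOnNhd_aeval_hyperplanePoint e j r Q₁)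
    (analyticOnNhd_aeval_hyperplanePoint e j r Q₂) h

theorem aeval_expPoint_id_rename (e : κ → Fin n) (P : MvPolynomial (Fin n ⊕ κ) F)
    (x : Fin n → ℝ) :
    aeval (expPoint id x) (rename (Sum.map id e) P) = aeval (expPoint e x) P := by
  rw [aeval_rename]
  congr 2
  ext (i | c) <;> rfl

end VanishingIdeal

section ExpDiffs

variable {F : Type*} [Field F] {n : ℕ} {κ : Type*}

theorem dvd_of_rename_dvd_rename {σ τ : Type*} {f : σ → τ} (hf : Function.Injective f)
    {p q : MvPolynomial σ F} (h : rename f p ∣ rename f q) : p ∣ q := by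
  simpa only [killCompl_rename_app] using map_dvd (killCompl hf) h

/-- The differences of exponents of pairs of distinct `U`-monomials of `P`. -/
def expDiffs (e : κ → Fin n) (P : MvPolynomial (Fin n ⊕ κ) F) : Finset (Fin n → ℤ) :=
  (nestEquiv F (Fin n) (Fin n) (rename (Sum.map id e) P)).support.offDiag.image
    fun p i => (p.1 i : ℤ) - p.2 i

theorem ne_zero_of_mem_expDiffs {e : κ → Fin n} {P : MvPolynomial (Fin n ⊕ κ) F}
    {δ : Fin n → ℤ} (h : δ ∈ expDiffs e P) : δ ≠ 0 := by
  rw [expDiffs, Finset.mem_image] at h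
  obtain ⟨⟨a, b⟩, hab, rfl⟩ := h
  intro h0
  refine (Finset.mem_offDiag.1 hab).2.2 (Finsupp.ext fun i => ?_)
  have := congrFun h0 i
  simp only [Pi.zero_apply] at this
  change a i = b i
  omega

theorem mem_range_of_mem_expDiffs {e : κ → Fin n} {P : MvPolynomial (Fin n ⊕ κ) F}
    {δ : Fin n → ℤ} (h : δ ∈ expDiffs e P) {i : Fin n} (hi : δ i ≠ 0) : i ∈ Set.range e := by
  rw [expDiffs, Finset.mem_image] at h
  obtain ⟨⟨a, b⟩, hab, rfl⟩ := h
  have key : ∀ c ∈ (nestEquiv F (Fin n) (Fin n) (rename (Sum.map id e) P)).support, c i ≠ 0 →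
      i ∈ Set.range e := by
    intro c hc hci
    obtain ⟨b, hb⟩ := MvPolynomial.ne_zero_iff.1 (mem_support_iff.1 hc)
    rw [coeff_coeff_nestEquiv] at hb
    have hv : Sum.inr i ∈ (rename (Sum.map id e) P).vars := by
      refine (mem_vars_iff_mem_support _).2 ⟨_, mem_support_iff.2 hb, ?_⟩
      rw [Finsupp.mem_support_iff]
      exact hci
    obtain ⟨w, -, hw⟩ := mem_vars_rename _ _ hv
    rcases w with w | w
    · simp at hw
    · exact ⟨w, by simpa using hw⟩
  obtain ⟨ha, hb, -⟩ := Finset.mem_offDiag.1 hab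
  by_contra hcon
  have h1 : a i = 0 := by_contra fun h => hcon (key a ha h)
  have h2 : b i = 0 := by_contra fun h => hcon (key b hb h)
  simp [h1, h2] at hi

end ExpDiffs

section Core

variable {F : Type} [Field F] [Algebra F ℝ] {d : ℕ} {κ : Type*} {e : κ → Fin (d + 1)}

theorem not_hyperplaneForm_dvd {P : MvPolynomial (Fin (d + 1) ⊕ κ) F} (hP : Irreducible P)
    (hH : ∀ j (r : Fin d → F), {x | aeval (expPoint e x) P = 0} ≠ Set.range (hyperplanePoint j r))
    (j : Fin (d + 1)) (r : Fin d → F) : ¬ rename Sum.inl (hyperplaneForm j r) ∣ P := by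
  intro h
  have hT := prime_rename (ι := (Sum.inl : Fin (d + 1) → Fin (d + 1) ⊕ κ)) Sum.inl_injective
    (prime_hyperplaneForm j r)
  have has := hT.irreducible.dvd_symm hP h
  refine hH j r (Set.ext fun x => ?_)
  rw [mem_range_hyperplanePoint (e := e), Set.mem_ofPred_eq]
  exact ⟨fun hx => zero_dvd_iff.1 (hx ▸ map_dvd (aeval (expPoint e x)) has),
    fun hx => zero_dvd_iff.1 (hx ▸ map_dvd (aeval (expPoint e x)) h)⟩

variable [NumberField F]

theorem SchanuelConjecture.exists_mem_expDiffs (hSch : SchanuelConjecture)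
    (he : Function.Injective e) {P : MvPolynomial (Fin (d + 1) ⊕ κ) F} (hP : Irreducible P)
    (hT : ∀ j (r : Fin d → F), ¬ rename Sum.inl (hyperplaneForm j r) ∣ P)
    {Q : MvPolynomial (Fin (d + 1) ⊕ Fin (d + 1)) F} (hPQ : ¬ rename (Sum.map id e) P ∣ Q)
    (j : Fin (d + 1)) {B : Set (Fin d → ℝ)} (hB : IsOpen B) (hBne : B.Nonempty)
    (g : (Fin d → ℝ) → ℝ)
    (hPz : ∀ x ∈ B, aeval (expPoint e (j.insertNth (α := fun _ => ℝ) (g x) x)) P = 0)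
    (hQz : ∀ x ∈ B, aeval (expPoint id (j.insertNth (α := fun _ => ℝ) (g x) x)) Q = 0) :
    ∃ x ∈ B, ∃ δ ∈ expDiffs e P,
      ∑ i, (δ i : ℝ) * j.insertNth (α := fun _ => ℝ) (g x) x i = 0 := by
  have hinj : Function.Injective (Sum.map id e : Fin (d + 1) ⊕ κ → _) :=
    Function.injective_id.sumMap he
  have hT' : ∀ r : Fin d → ℚ, ¬ rename Sum.inl (hyperplaneForm j fun i => (r i : F)) ∣
      rename (Sum.map id e) P := by
    intro r hr
    refine hT j (fun i => (r i : F)) (dvd_of_rename_dvd_rename hinj ?_)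
    rwa [rename_rename]
  obtain ⟨x, hx, a, ha, b, hb, hab, hsum⟩ := hSch.exists_pair_of_aeval_eq_zero
    (prime_rename hinj hP.prime).irreducible hPQ j hT' hB hBne
    (fun x => j.insertNth (α := fun _ => ℝ) (g x) x) (fun x i => by simp)
    (fun x hx => (aeval_expPoint_id_rename e P _).trans (hPz x hx)) hQz
  refine ⟨x, hx, _, Finset.mem_image_of_mem _ 
    (Finset.mem_offDiag.2 (⟨ha, hb, hab⟩ : (a, b).1 ∈ _ ∧ (a, b).2 ∈ _ ∧ _)), ?_⟩
  simpa using hsum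

theorem SchanuelConjecture.dvd_of_mem_expVanishingIdeal (hSch : SchanuelConjecture)
    (he : Function.Injective e) {P : MvPolynomial (Fin (d + 1) ⊕ κ) F} (hP : Irreducible P)
    {V : Set (Fin (d + 1) → ℝ)} (hV : V = {x | aeval (expPoint e x) P = 0})
    (hdim : dimH V = d) (hne : V.Nonempty) (hI : (expVanishingIdeal F e V).IsPrime)
    (hH : ∀ j (r : Fin d → F), V ≠ Set.range (hyperplanePoint j r))
    {Q : MvPolynomial (Fin (d + 1) ⊕ κ) F} (hQ : Q ∈ expVanishingIdeal F e V) : P ∣ Q := by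
  classical
  by_contra hPQ
  have hT := not_hyperplaneForm_dvd (e := e) hP (by rwa [← hV])
  have hinj : Function.Injective (Sum.map id e : Fin (d + 1) ⊕ κ → _) :=
    Function.injective_id.sumMap he
  obtain ⟨j, c, ε, g, hε, hg, hgz⟩ := exists_graph_of_dimH (analyticOnNhd_aeval_expPoint e P)
    (by
      by_contra! hall
      have : V = Set.univ := by rw [hV]; ext x; simp [hall x]
      rw [this, Real.dimH_univ_pi_fin] at hdim
      have : d + 1 = d := by exact_mod_cast hdim
      omega)
    (by rw [hV] at hne; exact hne) (by rw [← hV]; exact hdim)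
  have hmemV : ∀ x ∈ Metric.ball c ε, j.insertNth (α := fun _ => ℝ) (g x) x ∈ V := by
    intro x hx
    rw [hV]
    exact hgz x hx
  rw [mem_expVanishingIdeal] at hQ
  have hcont : ∀ i : Fin (d + 1), ContinuousOn
      (fun x => j.insertNth (α := fun _ => ℝ) (g x) x i) (Metric.ball c ε) := by
    intro i
    refine Fin.succAboveCases j ?_ (fun i => ?_) i
    · simpa using hg.continuousOn
    · simpa using (continuous_apply i).continuousOn
  obtain ⟨δ, hδ, B, hBs, hB, hBne, hBz⟩ := exists_isOpen_forall_eq_zero (expDiffs e P)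
    (fun δ x => ∑ i, (δ i : ℝ) * j.insertNth (α := fun _ => ℝ) (g x) x i)
    (Metric.isOpen_ball (x := c) (ε := ε)) ⟨c, Metric.mem_ball_self hε⟩
    (fun δ _ => continuousOn_finsetSum _ fun i _ => continuousOn_const.mul (hcont i))
    (fun B' hB's hB' hB'ne => hSch.exists_mem_expDiffs he hP hT
      (Q := rename (Sum.map id e) Q) (fun h => hPQ (dvd_of_rename_dvd_rename hinj h)) j hB' hB'ne g
      (fun x hx => hgz x (hB's hx))
      fun x hx => (aeval_expPoint_id_rename e Q _).trans (hQ _ (hmemV x (hB's hx))))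
  have hBz' : ∀ x ∈ B, (δ j : ℝ) * g x + ∑ i, (δ (j.succAbove i) : ℝ) * x i = 0 := by
    intro x hx
    have := hBz x hx
    rw [Fin.sum_univ_succAbove _ j] at this
    simpa using this
  have hδj : δ j ≠ 0 := by
    intro h0
    refine ne_zero_of_mem_expDiffs hδ (funext fun i => ?_)
    have := eq_zero_of_sum_mul_eq_zero_of_isOpen (a := fun i => (δ (j.succAbove i) : ℝ)) hB hBne
      (fun x hx => by simpa [h0] using hBz' x hx)
    refine Fin.succAboveCases j h0 (fun i => ?_) i
    simpa using congrFun this i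
  obtain ⟨c₀, rfl⟩ := mem_range_of_mem_expDiffs hδ hδj
  set j := e c₀ with hj
  set r : Fin d → F := fun i => -(δ (j.succAbove i) : F) / (δ j : F) with hr
  have hgr : ∀ x ∈ B, j.insertNth (α := fun _ => ℝ) (g x) x = hyperplanePoint j r x := by
    intro x hx
    have hδj' : (δ j : ℝ) ≠ 0 := by exact_mod_cast hδj
    rw [hyperplanePoint]
    congr 1
    have h1 : ∀ i, algebraMap F ℝ (r i) * x i =
        -(1 / (δ j : ℝ)) * ((δ (j.succAbove i) : ℝ) * x i) := by
      intro i
      simp only [hr, map_div₀, map_neg, map_intCast]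
      ring
    rw [Finset.sum_congr rfl fun i _ => h1 i, ← Finset.mul_sum]
    have := hBz' x hx
    field_simp
    linarith
  obtain ⟨x₀, hx₀⟩ := hBne
  have hHV : ∀ x, hyperplanePoint j r x ∈ V := by
    intro x
    rw [hV]
    have han := analyticOnNhd_aeval_hyperplanePoint e j r P
    refine han.eqOn_zero_of_preconnected_of_eventuallyEq_zero
      isPreconnected_univ (Set.mem_univ x₀) ?_ (Set.mem_univ x)
    filter_upwards [hB.mem_nhds hx₀] with y hy
    rw [← hgr y hy]
    exact hgz y (hBs hy)
  obtain ⟨R, hR0, hR⟩ := exists_ne_zero_rename_mem_span hP hPQ (Sum.inr c₀)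
  have hRI : rename Subtype.val R ∈ expVanishingIdeal F e V := by
    refine (Ideal.span_le.2 ?_ : Ideal.span {P, Q} ≤ expVanishingIdeal F e V) hR
    rintro p (rfl | rfl)
    · exact mem_expVanishingIdeal.2 fun x hx => by rw [hV] at hx; exact hx
    · exact mem_expVanishingIdeal.2 hQ
  set T : MvPolynomial {w : Fin (d + 1) ⊕ κ // w ≠ Sum.inr c₀} F :=
    rename (fun i => ⟨Sum.inl i, Sum.inl_ne_inr⟩) (hyperplaneForm j r) with hTdef
  have hTp : Prime T := prime_rename (fun a b hab => by simpa using hab) (prime_hyperplaneForm j r)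
  obtain ⟨R₁, hR₁, hRe⟩ :=
    (FiniteMultiplicity.of_not_isUnit hTp.not_isUnit hR0).exists_eq_pow_mul_and_not_dvd
  rw [hR₁, map_mul, map_pow] at hRI
  rcases hI.mem_or_mem hRI with h | h
  · have h := hI.mem_of_pow_mem _ h
    rw [hTdef, rename_rename, mem_expVanishingIdeal] at h
    refine hH j r (Set.Subset.antisymm (fun x hx => ?_) ?_)
    · rw [mem_range_hyperplanePoint (e := e)]
      exact h x hx
    · rintro _ ⟨x, rfl⟩
      exact hHV x
  · refine hRe (hSch.hyperplaneForm_dvd he c₀ r R₁ fun x => ?_)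
    have := mem_expVanishingIdeal.1 h _ (hHV x)
    rwa [aeval_rename] at this

/-- A point of the zero set where some partial derivative does not vanish and which avoids the
linear hyperplanes attached to `expDiffs`. -/
theorem SchanuelConjecture.exists_regular_point (hSch : SchanuelConjecture)
    (he : Function.Injective e) {P : MvPolynomial (Fin (d + 1) ⊕ κ) F} (hP : Irreducible P)
    {V : Set (Fin (d + 1) → ℝ)} (hV : V = {x | aeval (expPoint e x) P = 0})
    (hdim : dimH V = d) (hne : V.Nonempty) (hI : (expVanishingIdeal F e V).IsPrime)
    (hH : ∀ j (r : Fin d → F), V ≠ Set.range (hyperplanePoint j r)) :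
    ∃ p ∈ V, (∃ i, aeval (expPoint e p) (expDeriv F e i P) ≠ 0) ∧
      ∀ δ ∈ expDiffs e P, ∑ i, (δ i : ℝ) * p i ≠ 0 := by
  have hdvd := fun Q => hSch.dvd_of_mem_expVanishingIdeal he hP hV hdim hne hI hH (Q := Q)
  have hD : ∃ i, expDeriv F e i P ∉ expVanishingIdeal F e V := by
    by_contra! hall
    obtain ⟨q, hq⟩ := hne
    have hzero := aeval_expPoint_eq_zero_of_dvd e P (fun i => hdvd _ (hall i))
      (by rw [hV] at hq; exact hq)
    have : V = Set.univ := by rw [hV]; ext x; simp [hzero x]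
    rw [this, Real.dimH_univ_pi_fin] at hdim
    have : d + 1 = d := by exact_mod_cast hdim
    omega
  obtain ⟨i, hi⟩ := hD
  set L : (Fin (d + 1) → ℤ) → MvPolynomial (Fin (d + 1) ⊕ κ) F := fun δ =>
    ∑ i, C (δ i : F) * X (Sum.inl i) with hL
  have hLa : ∀ δ x, aeval (expPoint e x) (L δ) = ∑ i, (δ i : ℝ) * x i := by
    intro δ x
    simp [hL, expPoint]
  have hLI : ∀ δ ∈ expDiffs e P, L δ ∉ expVanishingIdeal F e V := by
    intro δ hδ hmem
    obtain ⟨j, hj⟩ := Function.ne_iff.1 (ne_zero_of_mem_expDiffs hδ)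
    have hj' : (δ j : ℝ) ≠ 0 := by exact_mod_cast hj
    set r : Fin d → F := fun i => -(δ (j.succAbove i) : F) / (δ j : F) with hr
    have hTI : rename Sum.inl (hyperplaneForm j r) ∈ expVanishingIdeal F e V := by
      refine mem_expVanishingIdeal.2 fun x hx => ?_
      have h1 := mem_expVanishingIdeal.1 hmem x hx
      rw [hLa, Fin.sum_univ_succAbove _ j] at h1
      rw [aeval_expPoint_hyperplaneForm]
      have h2 : ∀ i, algebraMap F ℝ (r i) * x (j.succAbove i) =
          -(1 / (δ j : ℝ)) * ((δ (j.succAbove i) : ℝ) * x (j.succAbove i)) := by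
        intro i
        simp only [hr, map_div₀, map_neg, map_intCast]
        ring
      rw [Finset.sum_congr rfl fun i _ => h2 i, ← Finset.mul_sum]
      field_simp
      linarith
    have hTp := prime_rename (ι := (Sum.inl : Fin (d + 1) → Fin (d + 1) ⊕ κ)) Sum.inl_injective
      (prime_hyperplaneForm j r)
    exact not_hyperplaneForm_dvd (e := e) hP (by rwa [← hV]) j r
      (hP.dvd_symm hTp.irreducible (hdvd _ hTI))
  have hprod : expDeriv F e i P * ∏ δ ∈ expDiffs e P, L δ ∉ expVanishingIdeal F e V := by
    intro h
    rcases hI.mem_or_mem h with h | h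
    · exact hi h
    · obtain ⟨δ, hδ, hδI⟩ := (hI.prod_mem_iff).1 h
      exact hLI δ hδ hδI
  rw [mem_expVanishingIdeal] at hprod
  push Not at hprod
  obtain ⟨p, hp, hpne⟩ := hprod
  rw [map_mul, map_prod] at hpne
  refine ⟨p, hp, ⟨i, left_ne_zero_of_mul hpne⟩, fun δ hδ => ?_⟩
  rw [← hLa]
  exact Finset.prod_ne_zero_iff.1 (right_ne_zero_of_mul hpne) δ hδ

theorem SchanuelConjecture.rename_dvd_of_mem_expVanishingIdeal (hSch : SchanuelConjecture)
    (he : Function.Injective e) {P : MvPolynomial (Fin (d + 1) ⊕ κ) F} (hP : Irreducible P)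
    {V : Set (Fin (d + 1) → ℝ)} (hV : V = {x | aeval (expPoint e x) P = 0})
    (hdim : dimH V = d) (hne : V.Nonempty) (hI : (expVanishingIdeal F e V).IsPrime)
    (hH : ∀ j (r : Fin d → F), V ≠ Set.range (hyperplanePoint j r))
    {Q : MvPolynomial (Fin (d + 1) ⊕ Fin (d + 1)) F} (hQ : Q ∈ expVanishingIdeal F id V) :
    rename (Sum.map id e) P ∣ Q := by
  by_contra hPQ
  obtain ⟨p, hp, ⟨j, hj⟩, hpδ⟩ := hSch.exists_regular_point he hP hV hdim hne hI hH
  rw [mem_expVanishingIdeal] at hQ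
  obtain ⟨ε, hε, g, hg, hgp, hgz, -⟩ := exists_graph
    (analyticOnNhd_aeval_expPoint e P p (Set.mem_univ p)) (by rw [hV] at hp; exact hp) j (by
      rw [(hasFDerivAt_aeval_expPoint e P p).fderiv]
      simpa [Pi.single_apply] using hj)
  have hcont : ContinuousOn (fun x => ∏ δ ∈ expDiffs e P,
      ∑ i, (δ i : ℝ) * j.insertNth (α := fun _ => ℝ) (g x) x i)
      (Metric.ball (j.removeNth p) ε) := by
    refine continuousOn_finsetProd _ fun δ _ => continuousOn_finsetSum _ fun i _ =>
      continuousOn_const.mul ?_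
    refine Fin.succAboveCases j ?_ (fun i => ?_) i
    · simpa using hg.continuousOn
    · simpa using (continuous_apply i).continuousOn
  have hpp : j.insertNth (α := fun _ => ℝ) (g (j.removeNth p)) (j.removeNth p) = p := by
    rw [hgp]
    exact Fin.insertNth_self_removeNth j p
  obtain ⟨x, hx, δ, hδ, h0⟩ := hSch.exists_mem_expDiffs he hP
    (not_hyperplaneForm_dvd (e := e) hP (by rwa [← hV])) hPQ j
    (hcont.isOpen_inter_preimage Metric.isOpen_ball (isOpen_compl_singleton (x := 0)))
    ⟨j.removeNth p, Metric.mem_ball_self hε, by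
      rw [Set.mem_preimage, hpp]
      exact Finset.prod_ne_zero_iff.2 hpδ⟩ g (fun x hx => hgz x hx.1)
    (fun x hx => hQ _ (by rw [hV]; exact hgz x hx.1))
  exact hx.2 (Finset.prod_eq_zero hδ h0)

theorem SchanuelConjecture.mem_or_mem_expVanishingIdeal (hSch : SchanuelConjecture)
    (he : Function.Injective e) {P : MvPolynomial (Fin (d + 1) ⊕ κ) F}
    {V : Set (Fin (d + 1) → ℝ)} (hV : V = {x | aeval (expPoint e x) P = 0})
    (hdim : dimH V = d) (hne : V.Nonempty) (hI : (expVanishingIdeal F e V).IsPrime)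
    {Q₁ Q₂ : MvPolynomial (Fin (d + 1) ⊕ Fin (d + 1)) F}
    (hQ : Q₁ * Q₂ ∈ expVanishingIdeal F id V) :
    Q₁ ∈ expVanishingIdeal F id V ∨ Q₂ ∈ expVanishingIdeal F id V := by
  by_cases hH : ∀ j (r : Fin d → F), V ≠ Set.range (hyperplanePoint j r)
  · obtain ⟨p, hp, hpV⟩ : ∃ p : MvPolynomial (Fin (d + 1) ⊕ κ) F, Irreducible p ∧
        V = {x | aeval (expPoint e x) p = 0} := by
      have hP0 : P ≠ 0 := by
        rintro rfl
        have : V = Set.univ := by rw [hV]; ext x; simp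
        rw [this, Real.dimH_univ_pi_fin] at hdim
        have : d + 1 = d := by exact_mod_cast hdim
        omega
      have hPI : P ∈ expVanishingIdeal F e V :=
        mem_expVanishingIdeal.2 fun x hx => by rw [hV] at hx; exact hx
      have hfac : (UniqueFactorizationMonoid.factors P).prod ∈ expVanishingIdeal F e V :=
        Ideal.mem_of_dvd _ (UniqueFactorizationMonoid.factors_prod hP0).symm.dvd hPI
      obtain ⟨p, hpf, hpI⟩ := (hI.multiset_prod_mem_iff_exists_mem _).1 hfac
      refine ⟨p, UniqueFactorizationMonoid.irreducible_of_factor p hpf,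
        Set.Subset.antisymm (fun x hx => mem_expVanishingIdeal.1 hpI x hx) fun x hx => ?_⟩
      rw [hV]
      exact zero_dvd_iff.1 (hx ▸ map_dvd (aeval (expPoint e x))
        (UniqueFactorizationMonoid.dvd_of_mem_factors hpf))
    have hprime := prime_rename (Function.injective_id.sumMap he :
      Function.Injective (Sum.map id e : Fin (d + 1) ⊕ κ → _)) hp.prime
    have hmem : ∀ Q, rename (Sum.map id e) p ∣ Q → Q ∈ expVanishingIdeal F id V := by
      refine fun Q hQ => Ideal.mem_of_dvd _ hQ (mem_expVanishingIdeal.2 fun x hx => ?_)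
      rw [aeval_expPoint_id_rename]
      rw [hpV] at hx
      exact hx
    exact (hprime.dvd_or_dvd (hSch.rename_dvd_of_mem_expVanishingIdeal he hp hpV hdim hne hI hH
      hQ)).imp (hmem _) (hmem _)
  · push Not at hH
    obtain ⟨j, r, rfl⟩ := hH
    exact mem_or_mem_expVanishingIdeal_hyperplane id j r hQ

end Core

theorem exists_map_algebraMap_eq {σ : Type*} {F : IntermediateField ℚ ℝ} {P : MvPolynomial σ ℝ}
    (hP : ∀ m ∈ P.support, P.coeff m ∈ F) :
    ∃ p : MvPolynomial σ F, map (algebraMap F ℝ) p = P := by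
  refine mem_range_map_iff_coeffs_subset.2 fun a ha => ?_
  obtain ⟨m, hm, rfl⟩ := mem_coeffs_iff.1 ha
  exact ⟨⟨_, hP m hm⟩, rfl⟩

/-- Finitely many real algebraic numbers of `K` generate a number field inside `K`. -/
theorem RealAlgExt.exists_numberField {K : Subfield ℝ} (hK : RealAlgExt K) {S : Set ℝ}
    (hS : S.Finite) (hSK : S ⊆ K) :
    ∃ F : IntermediateField ℚ ℝ, NumberField F ∧ S ⊆ F ∧ (F : Set ℝ) ⊆ K := by
  have : Finite S := hS
  have : FiniteDimensional ℚ (IntermediateField.adjoin ℚ S) :=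
    IntermediateField.finiteDimensional_adjoin fun x hx => (hK ⟨x, hSK hx⟩).isIntegral
  exact ⟨IntermediateField.adjoin ℚ S, { }, IntermediateField.subset_adjoin ℚ S,
    (IntermediateField.adjoin_le_iff (T := K.toIntermediateField fun q => by simp)).2 hSK⟩

theorem coeffsIn_map {σ L : Type*} [Field L] [Algebra L ℝ] {K : Subfield ℝ}
    (hL : ∀ a : L, algebraMap L ℝ a ∈ K) (p : MvPolynomial σ L) :
    CoeffsIn K (map (algebraMap L ℝ) p) := fun m => by
  rw [coeff_map]
  exact hL _

theorem isExpSetK_aeval {n k : ℕ} (hk : k ≤ n) {L : Type*} [Field L] [Algebra L ℝ]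
    {K : Subfield ℝ} (hL : ∀ a : L, algebraMap L ℝ a ∈ K) (p : MvPolynomial (Fin n ⊕ Fin k) L) :
    IsExpSetK hk K {x | aeval (expPoint (Fin.castLE hk) x) p = 0} :=
  ⟨_, coeffsIn_map hL p, by simp only [eval_map, aeval_def]; rfl⟩

theorem isExpSet_aeval {n : ℕ} {L : Type*} [Field L] [Algebra L ℝ]
    {K : Subfield ℝ} (hL : ∀ a : L, algebraMap L ℝ a ∈ K) (p : MvPolynomial (Fin n ⊕ Fin n) L) :
    IsExpSet K {x | aeval (expPoint id x) p = 0} :=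
  ⟨_, coeffsIn_map hL p, by simp only [expEval, eval_map, aeval_def]; rfl⟩

theorem isPrime_expVanishingIdeal {n k : ℕ} (hk : k ≤ n) {L : Type*} [Field L] [Algebra L ℝ]
    {K : Subfield ℝ} (hL : ∀ a : L, algebraMap L ℝ a ∈ K) (P : MvPolynomial (Fin n ⊕ Fin k) L)
    {V : Set (Fin n → ℝ)} (hV : V = {x | aeval (expPoint (Fin.castLE hk) x) P = 0})
    (hne : V.Nonempty)
    (hirr : ¬ ∃ V₁ V₂ : Set (Fin n → ℝ),
      IsExpSetK hk K V₁ ∧ IsExpSetK hk K V₂ ∧ V = V₁ ∪ V₂ ∧ V₁ ⊂ V ∧ V₂ ⊂ V) :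
    (expVanishingIdeal L (Fin.castLE hk) V).IsPrime := by
  refine ⟨fun h => ?_, fun {Q₁ Q₂} hQ => ?_⟩
  · obtain ⟨x, hx⟩ := hne
    have h1 := mem_expVanishingIdeal.1 ((Ideal.eq_top_iff_one _).1 h) x hx
    rw [map_one] at h1
    exact one_ne_zero h1
  · have hsq : ∀ Q x, aeval (expPoint (Fin.castLE hk) x) (P ^ 2 + Q ^ 2) = 0 ↔
        x ∈ V ∧ aeval (expPoint (Fin.castLE hk) x) Q = 0 := fun Q x => by
      rw [hV, map_add, map_pow, map_pow, add_eq_zero_iff_of_nonneg (sq_nonneg _) (sq_nonneg _),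
        sq_eq_zero_iff, sq_eq_zero_iff, Set.mem_ofPred_eq]
    by_contra! hcon
    have hss : ∀ Q ∉ expVanishingIdeal L (Fin.castLE hk) V,
        {x | aeval (expPoint (Fin.castLE hk) x) (P ^ 2 + Q ^ 2) = 0} ⊂ V := fun Q hQ => by
      refine ⟨fun x hx => ((hsq Q x).1 hx).1, fun h => hQ ?_⟩
      exact mem_expVanishingIdeal.2 fun x hx => ((hsq Q x).1 (h hx)).2
    refine hirr ⟨_, _, isExpSetK_aeval hk hL (P ^ 2 + Q₁ ^ 2),
      isExpSetK_aeval hk hL (P ^ 2 + Q₂ ^ 2), Set.Subset.antisymm (fun x hx => ?_)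
      (Set.union_subset (hss _ hcon.1).1 (hss _ hcon.2).1), hss _ hcon.1, hss _ hcon.2⟩
    have := mem_expVanishingIdeal.1 hQ x hx
    rw [map_mul, mul_eq_zero] at this
    exact this.imp (fun h => (hsq _ _).2 ⟨hx, h⟩) (fun h => (hsq _ _).2 ⟨hx, h⟩)

/-- Assuming Schanuel's conjecture: if `P ∈ 𝕂[X₁,…,Xₙ,U₁,…,U_k]` has `Z(P) ⊆ ℝ^{n+k}`
irreducible over `𝕂`, and `Z(f)` (with `f = P(x, e^{x₁},…,e^{x_k})`) is an
`(n-1)`-dimensional set irreducible in `𝕂[X, e^{X_k}]`, then `Z(f)` is irreducible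
as an exponential set over `𝕂`. -/
theorem stmt18 (hSch : SchanuelConjecture) (n k : ℕ) (hk : k ≤ n)
    (K : Subfield ℝ) (hK : RealAlgExt K)
    (P : MvPolynomial (Fin n ⊕ Fin k) ℝ) (hP : CoeffsIn K P)
    (hirr : IsIrredAlgSet K {z : Fin n ⊕ Fin k → ℝ | MvPolynomial.eval z P = 0})
    (V : Set (Fin n → ℝ))
    (hVdef : V = {x | MvPolynomial.eval
        (Sum.elim x fun j => Real.exp (x (Fin.castLE hk j))) P = 0})
    (hdim : dimH V = ((n - 1 : ℕ) : ℝ≥0∞))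
    (hne : V.Nonempty)
    (hirrk : ¬ ∃ V₁ V₂ : Set (Fin n → ℝ),
      IsExpSetK hk K V₁ ∧ IsExpSetK hk K V₂ ∧ V = V₁ ∪ V₂ ∧ V₁ ⊂ V ∧ V₂ ⊂ V) :
    IsIrredExpSet K V := by
  have hev : ∀ {σ : Type} {F : IntermediateField ℚ ℝ} (p : MvPolynomial σ F) (z : σ → ℝ),
      eval z (map (algebraMap F ℝ) p) = aeval z p := fun p z => by rw [eval_map, aeval_def]
  have hfield : ∀ Q₁ Q₂ : MvPolynomial (Fin n ⊕ Fin n) ℝ, CoeffsIn K Q₁ → CoeffsIn K Q₂ →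
      ∃ (F : IntermediateField ℚ ℝ) (p : MvPolynomial (Fin n ⊕ Fin k) F)
        (q₁ q₂ : MvPolynomial (Fin n ⊕ Fin n) F), NumberField F ∧
        (∀ a : F, algebraMap F ℝ a ∈ K) ∧ map (algebraMap F ℝ) p = P ∧
        map (algebraMap F ℝ) q₁ = Q₁ ∧ map (algebraMap F ℝ) q₂ = Q₂ := by
    intro Q₁ Q₂ h₁ h₂
    obtain ⟨F, hF, hSF, hFK⟩ := hK.exists_numberField
      (S := P.coeff '' P.support ∪ (Q₁.coeff '' Q₁.support ∪ Q₂.coeff '' Q₂.support))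
      ((P.support.finite_toSet.image _).union
        ((Q₁.support.finite_toSet.image _).union (Q₂.support.finite_toSet.image _))) (by
          rintro _ (⟨m, -, rfl⟩ | ⟨m, -, rfl⟩ | ⟨m, -, rfl⟩)
          exacts [hP m, h₁ m, h₂ m])
    obtain ⟨p, hp⟩ := exists_map_algebraMap_eq (F := F) (P := P)
      fun m hm => hSF (.inl ⟨m, hm, rfl⟩)
    obtain ⟨q₁, hq₁⟩ := exists_map_algebraMap_eq (F := F) (P := Q₁)
      fun m hm => hSF (.inr (.inl ⟨m, hm, rfl⟩))
    obtain ⟨q₂, hq₂⟩ := exists_map_algebraMap_eq (F := F) (P := Q₂)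
      fun m hm => hSF (.inr (.inr ⟨m, hm, rfl⟩))
    exact ⟨F, p, q₁, q₂, hF, fun a => hFK a.2, hp, hq₁, hq₂⟩
  refine ⟨?_, hne, ?_⟩
  · obtain ⟨F, p, -, -, -, hFK, rfl, -⟩ := hfield 0 0 (fun m => by simp) (fun m => by simp)
    convert isExpSet_aeval hFK (rename (Sum.map id (Fin.castLE hk)) p) using 1
    rw [hVdef]
    ext x
    rw [Set.mem_ofPred_eq, Set.mem_ofPred_eq, aeval_expPoint_id_rename, hev]
    rfl
  · rintro ⟨V₁, V₂, ⟨Q₁, hQ₁, hV₁⟩, ⟨Q₂, hQ₂, hV₂⟩, hU, hs₁, hs₂⟩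
    obtain ⟨F, p, q₁, q₂, hF, hFK, rfl, rfl, rfl⟩ := hfield Q₁ Q₂ hQ₁ hQ₂
    have hV : V = {x | aeval (expPoint (Fin.castLE hk) x) p = 0} := by
      simp only [hVdef, hev]; rfl
    replace hV₁ : V₁ = {x | aeval (expPoint id x) q₁ = 0} := by
      simp only [hV₁, expEval, hev]; rfl
    replace hV₂ : V₂ = {x | aeval (expPoint id x) q₂ = 0} := by
      simp only [hV₂, expEval, hev]; rfl
    cases n with
    | zero =>
      obtain ⟨x, hx⟩ := hne
      rw [hU] at hx
      rcases hx with hx | hx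
      · exact hs₁.2 fun y _ => Subsingleton.elim x y ▸ hx
      · exact hs₂.2 fun y _ => Subsingleton.elim x y ▸ hx
    | succ d =>
      rcases hSch.mem_or_mem_expVanishingIdeal (Fin.castLE_injective hk) hV (by simpa using hdim)
        hne (isPrime_expVanishingIdeal hk hFK p hV hne hirrk) (Q₁ := q₁) (Q₂ := q₂)
        (mem_expVanishingIdeal.2 fun x hx => by
          rw [map_mul, mul_eq_zero]
          rw [hU, hV₁, hV₂] at hx
          exact hx) with h | h
      · exact hs₁.2 fun x hx => hV₁ ▸ mem_expVanishingIdeal.1 h x hx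
      · exact hs₂.2 fun x hx => hV₂ ▸ mem_expVanishingIdeal.1 h x hx

end
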